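/- In the resolvent-sequence setting, define for 0 < α₁ < α₂ < β the quantity Jₙ(α₁, α₂) := ∫₀^{α₁} ( ρ₁ λₙ² |v¹ₙ|² + k₁ |v¹ₙ′|² + ρ₂ λₙ² |v³ₙ|² + k₂ |v³ₙ′|² + k₃ |v⁵ₙ′|² ) dx + ∫_{α₂}^{L} ( ρ₁ λₙ² |v¹ₙ|² + k₁ |v¹ₙ′|² + ρ₂ λₙ² |v³ₙ|² + k₂ |v³ₙ′|² + k₃ |v⁵ₙ′|² ) dx + ρ₁ λₙ² ∫_β^L |v⁵ₙ|² dx. If (H1) holds, then for every ε with 0 < ε < β/12: Jₙ(4ε, β−4ε) → 0 as n → ∞. -/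

import Mathlib

open Set Filter MeasureTheory

noncomputable section

/-- The resolvent-sequence setting for the locally damped Bresse system with
parameter `ℓ`: a sequence of nonzero frequencies `lam n` with `|lam n| → ∞`,
solutions `Uₙ = (v1,…,v6)` and right-hand sides `Fₙ = (f1,…,f6)` of the resolvent
equations `(lam n)^ℓ (i (lam n) I − 𝒜) Uₙ = Fₙ`, with `‖Uₙ‖_H = 1` and `‖Fₙ‖_H → 0`. -/
structure BresseSetting (ρ₁ ρ₂ k₁ k₂ k₃ l L β a₀ : ℝ) (ℓ : ℕ) where
  lam : ℕ → ℝ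
  v1 : ℕ → ℝ → ℂ
  v2 : ℕ → ℝ → ℂ
  v3 : ℕ → ℝ → ℂ
  v4 : ℕ → ℝ → ℂ
  v5 : ℕ → ℝ → ℂ
  v6 : ℕ → ℝ → ℂ
  f1 : ℕ → ℝ → ℂ
  f2 : ℕ → ℝ → ℂ
  f3 : ℕ → ℝ → ℂ
  f4 : ℕ → ℝ → ℂ
  f5 : ℕ → ℝ → ℂ
  f6 : ℕ → ℝ → ℂ
  lam_ne : ∀ n, lam n ≠ 0
  lam_tendsto : Tendsto (fun n => |lam n|) atTop atTop
  reg_v1 : ∀ n, ContDiffOn ℝ 2 (v1 n) (Icc 0 L)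
  reg_v3 : ∀ n, ContDiffOn ℝ 2 (v3 n) (Icc 0 L)
  reg_v5 : ∀ n, ContDiffOn ℝ 1 (v5 n) (Icc 0 L)
  reg_v5_left : ∀ n, ContDiffOn ℝ 2 (v5 n) (Icc 0 β)
  reg_v5_right : ∀ n, ContDiffOn ℝ 2 (v5 n) (Icc β L)
  reg_v2 : ∀ n, ContDiffOn ℝ 1 (v2 n) (Icc 0 L)
  reg_v4 : ∀ n, ContDiffOn ℝ 1 (v4 n) (Icc 0 L)
  reg_v6 : ∀ n, ContDiffOn ℝ 1 (v6 n) (Icc 0 L)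
  reg_f1 : ∀ n, ContDiffOn ℝ 1 (f1 n) (Icc 0 L)
  reg_f3 : ∀ n, ContDiffOn ℝ 1 (f3 n) (Icc 0 L)
  reg_f5 : ∀ n, ContDiffOn ℝ 1 (f5 n) (Icc 0 L)
  reg_f2 : ∀ n, ContinuousOn (f2 n) (Icc 0 L)
  reg_f4 : ∀ n, ContinuousOn (f4 n) (Icc 0 L)
  reg_f6 : ∀ n, ContinuousOn (f6 n) (Icc 0 L)
  bc_zero : ∀ n, v1 n 0 = 0 ∧ v2 n 0 = 0 ∧ v3 n 0 = 0 ∧ v4 n 0 = 0 ∧ v5 n 0 = 0 ∧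
      v6 n 0 = 0 ∧ f1 n 0 = 0 ∧ f3 n 0 = 0 ∧ f5 n 0 = 0
  bc_L : ∀ n, v1 n L = 0 ∧ v2 n L = 0 ∧ v3 n L = 0 ∧ v4 n L = 0 ∧ v5 n L = 0 ∧
      v6 n L = 0 ∧ f1 n L = 0 ∧ f3 n L = 0 ∧ f5 n L = 0
  eq1 : ∀ n, ∀ x ∈ Ioo (0 : ℝ) β ∪ Ioo β L,
      Complex.I * (lam n : ℂ) * v1 n x - v2 n x = (lam n : ℂ) ^ (-(ℓ : ℤ)) * f1 n x
  eq2 : ∀ n, ∀ x ∈ Ioo (0 : ℝ) β ∪ Ioo β L,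
      Complex.I * (lam n : ℂ) * (ρ₁ : ℂ) * v2 n x
        - (k₁ : ℂ) * deriv (fun y => deriv (v1 n) y + v3 n y + (l : ℂ) * v5 n y) x
        - (l : ℂ) * (k₃ : ℂ) * (deriv (v5 n) x - (l : ℂ) * v1 n x)
        = (ρ₁ : ℂ) * (lam n : ℂ) ^ (-(ℓ : ℤ)) * f2 n x
  eq3 : ∀ n, ∀ x ∈ Ioo (0 : ℝ) β ∪ Ioo β L,
      Complex.I * (lam n : ℂ) * v3 n x - v4 n x = (lam n : ℂ) ^ (-(ℓ : ℤ)) * f3 n x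
  eq4 : ∀ n, ∀ x ∈ Ioo (0 : ℝ) β ∪ Ioo β L,
      Complex.I * (lam n : ℂ) * (ρ₂ : ℂ) * v4 n x
        - (k₂ : ℂ) * deriv (deriv (v3 n)) x
        + (k₁ : ℂ) * (deriv (v1 n) x + v3 n x + (l : ℂ) * v5 n x)
        = (ρ₂ : ℂ) * (lam n : ℂ) ^ (-(ℓ : ℤ)) * f4 n x
  eq5 : ∀ n, ∀ x ∈ Ioo (0 : ℝ) β ∪ Ioo β L,
      Complex.I * (lam n : ℂ) * v5 n x - v6 n x = (lam n : ℂ) ^ (-(ℓ : ℤ)) * f5 n x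
  eq6 : ∀ n, ∀ x ∈ Ioo (0 : ℝ) β ∪ Ioo β L,
      Complex.I * (lam n : ℂ) * (ρ₁ : ℂ) * v6 n x
        - (k₃ : ℂ) * deriv (fun y => deriv (v5 n) y - (l : ℂ) * v1 n y) x
        + (l : ℂ) * (k₁ : ℂ) * (deriv (v1 n) x + v3 n x + (l : ℂ) * v5 n x)
        + (if x < β then (a₀ : ℂ) else 0) * v6 n x
        = (ρ₁ : ℂ) * (lam n : ℂ) ^ (-(ℓ : ℤ)) * f6 n x
  normU : ∀ n, (∫ x in (0 : ℝ)..L,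
      (k₁ * ‖deriv (v1 n) x + v3 n x + (l : ℂ) * v5 n x‖ ^ 2 + ρ₁ * ‖v2 n x‖ ^ 2
        + k₂ * ‖deriv (v3 n) x‖ ^ 2 + ρ₂ * ‖v4 n x‖ ^ 2
        + k₃ * ‖deriv (v5 n) x - (l : ℂ) * v1 n x‖ ^ 2 + ρ₁ * ‖v6 n x‖ ^ 2)) = 1
  normF : Tendsto (fun n => ∫ x in (0 : ℝ)..L,
      (k₁ * ‖deriv (f1 n) x + f3 n x + (l : ℂ) * f5 n x‖ ^ 2 + ρ₁ * ‖f2 n x‖ ^ 2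
        + k₂ * ‖deriv (f3 n) x‖ ^ 2 + ρ₂ * ‖f4 n x‖ ^ 2
        + k₃ * ‖deriv (f5 n) x - (l : ℂ) * f1 n x‖ ^ 2 + ρ₁ * ‖f6 n x‖ ^ 2))
      atTop (nhds 0)

open scoped ComplexConjugate

/-- Two-sided Gronwall estimate. -/
lemma bh_gronwall {L β C0 : ℝ} (hC : 0 ≤ C0) (E D R : ℝ → ℝ)
    (hE : ContinuousOn E (Icc 0 L))
    (hD : ∀ x ∈ Ioo 0 L, x ≠ β → HasDerivAt E (D x) x)
    (hDi : IntervalIntegrable D volume 0 L) (hRi : IntervalIntegrable R volume 0 L)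
    (hR : ∀ x, 0 ≤ R x) (hb : ∀ x, |D x| ≤ C0 * E x + R x) (hE0 : ∀ x, 0 ≤ E x) :
    ∀ x ∈ Icc 0 L, ∀ y ∈ Icc 0 L, E x ≤ Real.exp (C0 * L) * (E y + ∫ t in (0:ℝ)..L, R t) := by
  have key : ∀ (c : ℝ), ∀ u ∈ Icc 0 L, ∀ v ∈ Icc 0 L, u ≤ v →
      IntervalIntegrable (fun t => Real.exp (c * t) * (c * E t + D t)) volume u v ∧
      ∫ t in u..v, Real.exp (c * t) * (c * E t + D t)
        = Real.exp (c * v) * E v - Real.exp (c * u) * E u := by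
    intro c u hu v hv huv
    have hsub : Icc u v ⊆ Icc 0 L := Icc_subset_Icc hu.1 hv.2
    have hEc : ContinuousOn E (Icc u v) := hE.mono hsub
    have hDi' : IntervalIntegrable D volume u v := hDi.mono_set (by
      rw [uIcc_of_le huv, uIcc_of_le (hu.1.trans hu.2)]; exact hsub)
    have hEi : IntervalIntegrable E volume u v := hEc.intervalIntegrable_of_Icc huv
    have hi : IntervalIntegrable (fun t => Real.exp (c * t) * (c * E t + D t)) volume u v := by
      apply IntervalIntegrable.continuousOn_mul
      · exact (hEi.const_mul c).add hDi'
      · fun_prop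
    refine ⟨hi, ?_⟩
    refine integral_eq_of_hasDerivAt_off_countable_of_le
      (fun t => Real.exp (c * t) * E t) _ huv (s := {β}) (countable_singleton β) ?_ ?_ hi
    · exact ContinuousOn.mul (by fun_prop) hEc
    · rintro x ⟨hx, hxb⟩
      have h1 := hD x ⟨lt_of_le_of_lt hu.1 hx.1, lt_of_lt_of_le hx.2 hv.2⟩ (by simpa using hxb)
      have h2 : HasDerivAt (fun t => Real.exp (c * t)) (Real.exp (c * x) * (c * 1)) x :=
        ((hasDerivAt_id x).const_mul c).exp
      refine (h2.mul h1).congr_deriv ?_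
      ring
  have hRm : ∀ u ∈ Icc 0 L, ∀ v ∈ Icc 0 L, u ≤ v →
      IntervalIntegrable R volume u v ∧ ∫ t in u..v, R t ≤ ∫ t in (0:ℝ)..L, R t := by
    intro u hu v hv huv
    refine ⟨hRi.mono_set (by
      rw [uIcc_of_le huv, uIcc_of_le (hu.1.trans hu.2)]; exact Icc_subset_Icc hu.1 hv.2), ?_⟩
    exact intervalIntegral.integral_mono_interval hu.1 huv hv.2
      (Eventually.of_forall hR) hRi
  intro x hx y hy
  have hexp : ∀ t ∈ Icc 0 L, Real.exp (C0 * t) ≤ Real.exp (C0 * L) := fun t ht =>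
    Real.exp_le_exp.2 (mul_le_mul_of_nonneg_left ht.2 hC)
  have hexp1 : ∀ t ∈ Icc 0 L, 1 ≤ Real.exp (C0 * t) := fun t ht =>
    Real.one_le_exp (mul_nonneg hC ht.1)
  have hI0 : 0 ≤ ∫ t in (0:ℝ)..L, R t :=
    intervalIntegral.integral_nonneg (hx.1.trans hx.2) (fun t _ => hR t)
  rcases le_total y x with hyx | hxy
  · obtain ⟨hi, he⟩ := key (-C0) y hy x hx hyx
    obtain ⟨hr, hrl⟩ := hRm y hy x hx hyx
    have hle : ∫ t in y..x, Real.exp (-C0 * t) * (-C0 * E t + D t) ≤ ∫ t in y..x, R t := by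
      refine intervalIntegral.integral_mono_on hyx hi hr fun t ht => ?_
      have h1 : Real.exp (-C0 * t) ≤ 1 := by
        rw [Real.exp_le_one_iff]; nlinarith [ht.1, hy.1]
      have h2 : -C0 * E t + D t ≤ R t := by linarith [(abs_le.1 (hb t)).2]
      calc _ ≤ Real.exp (-C0 * t) * R t := mul_le_mul_of_nonneg_left h2 (Real.exp_pos _).le
        _ ≤ 1 * R t := mul_le_mul_of_nonneg_right h1 (hR t)
        _ = R t := one_mul _
    have h3 : Real.exp (-C0 * x) * E x ≤ E y + ∫ t in (0:ℝ)..L, R t := by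
      have h1 : Real.exp (-C0 * y) ≤ 1 := by
        rw [Real.exp_le_one_iff]; nlinarith [hy.1]
      nlinarith [hE0 y]
    have h4 : E x = Real.exp (C0 * x) * (Real.exp (-C0 * x) * E x) := by
      rw [← mul_assoc, ← Real.exp_add]; simp
    rw [h4]
    exact mul_le_mul (hexp x hx) h3 (mul_nonneg (Real.exp_pos _).le (hE0 x)) (Real.exp_pos _).le
  · obtain ⟨hi, he⟩ := key C0 x hx y hy hxy
    obtain ⟨hr, hrl⟩ := hRm x hx y hy hxy
    have hle : ∫ t in x..y, -(Real.exp (C0 * L) * R t)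
        ≤ ∫ t in x..y, Real.exp (C0 * t) * (C0 * E t + D t) := by
      refine intervalIntegral.integral_mono_on hxy (hr.const_mul _).neg hi fun t ht => ?_
      have h2 : -R t ≤ C0 * E t + D t := by linarith [(abs_le.1 (hb t)).1]
      have h5 := hexp t ⟨hx.1.trans ht.1, ht.2.trans hy.2⟩
      calc _ ≤ -(Real.exp (C0 * t) * R t) := by nlinarith [hR t]
        _ = Real.exp (C0 * t) * (-R t) := by ring
        _ ≤ _ := mul_le_mul_of_nonneg_left h2 (Real.exp_pos _).le
    rw [intervalIntegral.integral_neg, intervalIntegral.integral_const_mul] at hle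
    have h6 := hexp y hy
    have h7 := hexp1 x hx
    have h8 : Real.exp (C0 * L) * (∫ t in x..y, R t) ≤ Real.exp (C0 * L) * ∫ t in (0:ℝ)..L, R t :=
      mul_le_mul_of_nonneg_left hrl (Real.exp_pos _).le
    nlinarith [hE0 x, hE0 y]

lemma bh_normsq_deriv {p : ℝ → ℂ} {p' : ℂ} {x : ℝ} (h : HasDerivAt p p' x) :
    HasDerivAt (fun t => ‖p t‖ ^ 2) (2 * (p' * conj (p x)).re) x := by
  have := h.norm_sq
  convert this using 2
  simp [Complex.inner]

/-- square-integrable (with integrability) on `[0,L]` -/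
def BhL2 (L : ℝ) (u : ℝ → ℂ) : Prop :=
  IntervalIntegrable u volume 0 L ∧ IntervalIntegrable (fun x => ‖u x‖ ^ 2) volume 0 L

lemma BhL2.of_cont {L : ℝ} (hL : 0 ≤ L) {u : ℝ → ℂ} (h : ContinuousOn u (Icc 0 L)) :
    BhL2 L u :=
  ⟨h.intervalIntegrable_of_Icc hL, (h.norm.pow 2).intervalIntegrable_of_Icc hL⟩

lemma BhL2.add {L : ℝ} {u w : ℝ → ℂ} (hu : BhL2 L u) (hw : BhL2 L w) :
    BhL2 L (fun x => u x + w x) := by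
  refine ⟨hu.1.add hw.1, ?_⟩
  refine ((hu.2.const_mul 2).add (hw.2.const_mul 2)).mono_fun' ?_ ?_
  · exact ((hu.1.add hw.1).aestronglyMeasurable_restrict_uIoc.norm.pow 2)
  · refine Eventually.of_forall fun x => ?_
    simp only [norm_pow, norm_norm]
    have := norm_add_le (u x) (w x)
    have h0 := norm_nonneg (u x + w x)
    nlinarith [sq_nonneg (‖u x‖ - ‖w x‖)]

lemma BhL2.const_mul {L : ℝ} {u : ℝ → ℂ} (hu : BhL2 L u) (c : ℂ) :
    BhL2 L (fun x => c * u x) := by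
  refine ⟨hu.1.const_mul c, ?_⟩
  have := hu.2.const_mul (‖c‖ ^ 2)
  simpa [mul_pow] using this

/-- product of two L2 functions is integrable -/
lemma BhL2.mul {L : ℝ} {u w : ℝ → ℂ} (hu : BhL2 L u) (hw : BhL2 L w) :
    IntervalIntegrable (fun x => u x * conj (w x)) volume 0 L := by
  refine (hu.2.add hw.2).mono_fun' ?_ ?_
  · have h1 := hu.1.aestronglyMeasurable_restrict_uIoc
    have h2 := hw.1.aestronglyMeasurable_restrict_uIoc
    exact h1.mul (Complex.continuous_conj.comp_aestronglyMeasurable h2)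
  · refine Eventually.of_forall fun x => ?_
    simp only [norm_mul, RCLike.norm_conj]
    nlinarith [sq_nonneg (‖u x‖ - ‖w x‖), sq_nonneg (‖u x‖ + ‖w x‖)]

lemma bh_re_int {L : ℝ} {u : ℝ → ℂ} (h : IntervalIntegrable u volume 0 L) :
    IntervalIntegrable (fun x => (u x).re) volume 0 L := by
  refine h.norm.mono_fun' ?_ ?_
  · exact Complex.continuous_re.comp_aestronglyMeasurable h.aestronglyMeasurable_restrict_uIoc
  · exact Eventually.of_forall fun x => Complex.abs_re_le_norm _

/-- tends to zero in L2 on `[0,L]` -/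
def BhT2 (L : ℝ) (u : ℕ → ℝ → ℂ) : Prop :=
  (∀ n, BhL2 L (u n)) ∧ Tendsto (fun n => ∫ x in (0:ℝ)..L, ‖u n x‖ ^ 2) atTop (nhds 0)

lemma BhT2.of_le {L : ℝ} (hL : 0 ≤ L) {u : ℕ → ℝ → ℂ} (hu : ∀ n, BhL2 L (u n))
    {δ : ℕ → ℝ} (hδ : Tendsto δ atTop (nhds 0))
    (h : ∀ n, ∫ x in (0:ℝ)..L, ‖u n x‖ ^ 2 ≤ δ n) : BhT2 L u :=
  ⟨hu, squeeze_zero (fun n => intervalIntegral.integral_nonneg hL fun x _ => by positivity) h hδ⟩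

lemma BhT2.add {L : ℝ} (hL : 0 ≤ L) {u w : ℕ → ℝ → ℂ} (hu : BhT2 L u) (hw : BhT2 L w) :
    BhT2 L (fun n x => u n x + w n x) := by
  have hlim := (hu.2.const_mul 2).add (hw.2.const_mul 2)
  simp only [mul_zero, add_zero] at hlim
  refine BhT2.of_le hL (fun n => (hu.1 n).add (hw.1 n)) hlim fun n => ?_
  rw [← intervalIntegral.integral_const_mul, ← intervalIntegral.integral_const_mul,
    ← intervalIntegral.integral_add ((hu.1 n).2.const_mul 2) ((hw.1 n).2.const_mul 2)]
  refine intervalIntegral.integral_mono_on hL ((hu.1 n).add (hw.1 n)).2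
    (((hu.1 n).2.const_mul 2).add ((hw.1 n).2.const_mul 2)) fun x _ => ?_
  have := norm_add_le (u n x) (w n x)
  have h0 := norm_nonneg (u n x + w n x)
  nlinarith [sq_nonneg (‖u n x‖ - ‖w n x‖)]

lemma BhT2.const_mul {L : ℝ} {u : ℕ → ℝ → ℂ} (hu : BhT2 L u) (c : ℂ) :
    BhT2 L (fun n x => c * u n x) := by
  refine ⟨fun n => (hu.1 n).const_mul c, ?_⟩
  have := hu.2.const_mul (‖c‖ ^ 2)
  simpa [mul_pow, intervalIntegral.integral_const_mul] using this

lemma BhT2.congr {L : ℝ} {u w : ℕ → ℝ → ℂ} (hu : BhT2 L u) (h : ∀ n x, u n x = w n x) :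
    BhT2 L w := by
  have : u = w := by funext n x; exact h n x
  exact this ▸ hu


lemma bh_csq {b : ℝ} (hb : 0 < b) {g : ℝ → ℝ} (h1 : IntervalIntegrable g volume 0 b)
    (h2 : IntervalIntegrable (fun x => g x ^ 2) volume 0 b) :
    (∫ x in (0:ℝ)..b, g x) ^ 2 ≤ b * ∫ x in (0:ℝ)..b, g x ^ 2 := by
  set I := ∫ x in (0:ℝ)..b, g x with hI
  set c := I / b with hc
  have h0 : 0 ≤ ∫ x in (0:ℝ)..b, (g x ^ 2 - (2 * c) * g x + c ^ 2) :=
    intervalIntegral.integral_nonneg hb.le fun x _ => by nlinarith [sq_nonneg (g x - c)]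
  rw [intervalIntegral.integral_add (h2.sub (h1.const_mul _)) intervalIntegrable_const,
    intervalIntegral.integral_sub h2 (h1.const_mul _), intervalIntegral.integral_const_mul,
    intervalIntegral.integral_const, ← hI] at h0
  have hcb : c * b = I := by rw [hc]; field_simp
  simp only [sub_zero, smul_eq_mul] at h0
  have : b * (2 * c * I) = 2 * I ^ 2 := by rw [← hcb]; ring
  have h3 : b * (b * c ^ 2) = I ^ 2 := by rw [← hcb]; ring
  nlinarith

/-- weighted L1 convergence to zero on `[0,β]` -/
def BhS (β : ℝ) (u : ℕ → ℝ → ℂ) : Prop :=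
  (∀ n, IntervalIntegrable (u n) volume 0 β) ∧
    Tendsto (fun n => ∫ x in (0:ℝ)..β, (x * (β - x)) * ‖u n x‖) atTop (nhds 0)

/-- uniformly bounded sequence of continuous functions -/
def BhB (β : ℝ) (w : ℕ → ℝ → ℂ) : Prop :=
  (∀ n, ContinuousOn (w n) (Icc 0 β)) ∧ ∃ M : ℝ, ∀ n, ∀ x ∈ Icc 0 β, ‖w n x‖ ≤ M

lemma bh_wint {β : ℝ} {u : ℝ → ℝ} (h : IntervalIntegrable u volume 0 β) :
    IntervalIntegrable (fun x => (x * (β - x)) * u x) volume 0 β :=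
  h.continuousOn_mul (by fun_prop)

lemma bh_chi {β x : ℝ} (hx : x ∈ Icc 0 β) : 0 ≤ x * (β - x) :=
  mul_nonneg hx.1 (by linarith [hx.2])

lemma BhS.of_le {β : ℝ} (hβ : 0 ≤ β) {u : ℕ → ℝ → ℂ}
    (hu : ∀ n, IntervalIntegrable (u n) volume 0 β)
    {δ : ℕ → ℝ} (hδ : Tendsto δ atTop (nhds 0))
    (h : ∀ n, ∫ x in (0:ℝ)..β, (x * (β - x)) * ‖u n x‖ ≤ δ n) : BhS β u :=
  ⟨hu, squeeze_zero (fun n => intervalIntegral.integral_nonneg hβ fun x hx =>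
    mul_nonneg (bh_chi hx) (norm_nonneg _)) h hδ⟩

lemma BhS.congr {β : ℝ} {u w : ℕ → ℝ → ℂ} (hu : BhS β u) (h : ∀ n x, w n x = u n x) :
    BhS β w := by
  have : u = w := by funext n x; exact (h n x).symm
  exact this ▸ hu

lemma BhS.add {β : ℝ} (hβ : 0 ≤ β) {u w : ℕ → ℝ → ℂ} (hu : BhS β u) (hw : BhS β w) :
    BhS β (fun n x => u n x + w n x) := by
  have hlim := hu.2.add hw.2
  simp only [add_zero] at hlim
  refine BhS.of_le hβ (fun n => (hu.1 n).add (hw.1 n)) hlim fun n => ?_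
  rw [← intervalIntegral.integral_add (bh_wint (hu.1 n).norm) (bh_wint (hw.1 n).norm)]
  refine intervalIntegral.integral_mono_on hβ (bh_wint ((hu.1 n).add (hw.1 n)).norm)
    ((bh_wint (hu.1 n).norm).add (bh_wint (hw.1 n).norm)) fun x hx => ?_
  rw [← mul_add]
  exact mul_le_mul_of_nonneg_left (norm_add_le _ _) (bh_chi hx)

lemma BhS.mul {β : ℝ} (hβ : 0 ≤ β) {u w : ℕ → ℝ → ℂ} (hw : BhB β w) (hu : BhS β u) :
    BhS β (fun n x => w n x * u n x) := by
  obtain ⟨M, hM⟩ := hw.2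
  have hlim := hu.2.const_mul M
  simp only [mul_zero] at hlim
  have hi : ∀ n, IntervalIntegrable (fun x => w n x * u n x) volume 0 β := fun n =>
    (hu.1 n).continuousOn_mul (by rw [uIcc_of_le hβ]; exact hw.1 n)
  refine BhS.of_le hβ hi hlim fun n => ?_
  rw [← intervalIntegral.integral_const_mul]
  refine intervalIntegral.integral_mono_on hβ (bh_wint (hi n).norm)
    ((bh_wint (hu.1 n).norm).const_mul M) fun x hx => ?_
  have h1 := mul_le_mul_of_nonneg_right (hM n x hx) (norm_nonneg (u n x))
  have := mul_le_mul_of_nonneg_left h1 (bh_chi hx)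
  rw [norm_mul]; linarith

lemma bh_star_int {a b : ℝ} {u : ℝ → ℂ} (h : IntervalIntegrable u volume a b) :
    IntervalIntegrable (fun x => conj (u x)) volume a b := by
  refine h.norm.mono_fun' ?_ ?_
  · exact Complex.continuous_conj.comp_aestronglyMeasurable h.aestronglyMeasurable_restrict_uIoc
  · exact Eventually.of_forall fun x => by simp

lemma BhS.conj {β : ℝ} {u : ℕ → ℝ → ℂ} (hu : BhS β u) :
    BhS β (fun n x => conj (u n x)) :=
  ⟨fun n => bh_star_int (hu.1 n), by simpa using hu.2⟩

lemma BhB.conj {β : ℝ} {u : ℕ → ℝ → ℂ} (hu : BhB β u) :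
    BhB β (fun n x => conj (u n x)) :=
  ⟨fun n => Complex.continuous_conj.comp_continuousOn (hu.1 n), by simpa using hu.2⟩

lemma BhB.const {β : ℝ} (c : ℂ) : BhB β (fun _ _ => c) :=
  ⟨fun _ => continuousOn_const, ‖c‖, fun _ _ _ => le_rfl⟩

lemma BhB.mul {β : ℝ} {u w : ℕ → ℝ → ℂ} (hu : BhB β u) (hw : BhB β w) :
    BhB β (fun n x => u n x * w n x) := by
  obtain ⟨M, hM⟩ := hu.2
  obtain ⟨N, hN⟩ := hw.2
  refine ⟨fun n => (hu.1 n).mul (hw.1 n), M * N, fun n x hx => ?_⟩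
  rw [norm_mul]
  exact mul_le_mul (hM n x hx) (hN n x hx) (norm_nonneg _) ((norm_nonneg _).trans (hM n x hx))

lemma BhB.add {β : ℝ} {u w : ℕ → ℝ → ℂ} (hu : BhB β u) (hw : BhB β w) :
    BhB β (fun n x => u n x + w n x) := by
  obtain ⟨M, hM⟩ := hu.2
  obtain ⟨N, hN⟩ := hw.2
  refine ⟨fun n => (hu.1 n).add (hw.1 n), M + N, fun n x hx => ?_⟩
  exact (norm_add_le _ _).trans (add_le_add (hM n x hx) (hN n x hx))

lemma bh_inv_tendsto {lam : ℕ → ℝ} (h : Tendsto (fun n => |lam n|) atTop atTop) :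
    Tendsto (fun n => ‖((lam n : ℂ))⁻¹‖) atTop (nhds 0) := by
  have := h.inv_tendsto_atTop
  refine this.congr fun n => ?_
  simp

lemma BhB.inv {β : ℝ} {lam : ℕ → ℝ} (h : Tendsto (fun n => |lam n|) atTop atTop) :
    BhB β (fun n _ => ((lam n : ℂ))⁻¹) := by
  obtain ⟨M, hM⟩ := (bh_inv_tendsto h).bddAbove_range
  exact ⟨fun _ => continuousOn_const, M, fun n _ _ => hM ⟨n, rfl⟩⟩

lemma BhB.int {β : ℝ} (hβ : 0 ≤ β) {u : ℕ → ℝ → ℂ} (hu : BhB β u) (n : ℕ) :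
    IntervalIntegrable (u n) volume 0 β :=
  (hu.1 n).intervalIntegrable_of_Icc hβ

lemma BhB.inv_mul {β : ℝ} (hβ : 0 ≤ β) {lam : ℕ → ℝ}
    (h : Tendsto (fun n => |lam n|) atTop atTop) {u : ℕ → ℝ → ℂ} (hu : BhB β u) :
    BhS β (fun n x => ((lam n : ℂ))⁻¹ * u n x) := by
  obtain ⟨M, hM⟩ := hu.2
  have hB := (BhB.inv (β := β) h).mul hu
  have hlim := (bh_inv_tendsto h).mul_const (∫ x in (0:ℝ)..β, (x * (β - x)) * M)
  simp only [zero_mul] at hlim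
  refine BhS.of_le hβ (hB.int hβ) hlim fun n => ?_
  rw [← intervalIntegral.integral_const_mul]
  refine intervalIntegral.integral_mono_on hβ (bh_wint (hB.int hβ n).norm)
    (Continuous.intervalIntegrable (by fun_prop) _ _) fun x hx => ?_
  rw [norm_mul]
  have h1 := mul_le_mul_of_nonneg_left (hM n x hx) (norm_nonneg ((lam n : ℂ))⁻¹)
  have := mul_le_mul_of_nonneg_left h1 (bh_chi hx)
  linarith

/-- weighted L2 smallness gives weighted L1 smallness -/
lemma BhS.of_sq {β : ℝ} (hβ : 0 < β) {p : ℕ → ℝ → ℂ}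
    (hp : ∀ n, ContinuousOn (p n) (Icc 0 β))
    (h : Tendsto (fun n => ∫ x in (0:ℝ)..β, (x * (β - x)) ^ 2 * ‖p n x‖ ^ 2) atTop (nhds 0)) :
    BhS β p := by
  have hlim := (h.const_mul β).sqrt
  simp only [mul_zero, Real.sqrt_zero] at hlim
  have hc : ∀ n, ContinuousOn (fun x => (x * (β - x)) * ‖p n x‖) (Icc 0 β) := fun n =>
    ContinuousOn.mul (by fun_prop) (hp n).norm
  refine BhS.of_le hβ.le (fun n => (hp n).intervalIntegrable_of_Icc hβ.le) hlim fun n => ?_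
  refine Real.le_sqrt_of_sq_le ?_
  have := bh_csq hβ ((hc n).intervalIntegrable_of_Icc hβ.le)
    (((hc n).pow 2).intervalIntegrable_of_Icc hβ.le)
  simpa only [mul_pow] using this

lemma BhS.sq {β : ℝ} (hβ : 0 ≤ β) {p : ℕ → ℝ → ℂ} (hB : BhB β p) (h : BhS β p) :
    Tendsto (fun n => ∫ x in (0:ℝ)..β, (x * (β - x)) ^ 2 * ‖p n x‖ ^ 2) atTop (nhds 0) := by
  obtain ⟨M, hM⟩ := hB.2
  have hlim := h.2.const_mul (β ^ 2 * M)
  simp only [mul_zero] at hlim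
  refine squeeze_zero (fun n => intervalIntegral.integral_nonneg hβ fun x hx => by positivity)
    (fun n => ?_) hlim
  rw [← intervalIntegral.integral_const_mul]
  refine intervalIntegral.integral_mono_on hβ ?_ ((bh_wint (h.1 n).norm).const_mul _)
    fun x hx => ?_
  · refine ContinuousOn.intervalIntegrable_of_Icc hβ ?_
    exact ContinuousOn.mul (by fun_prop) ((hB.1 n).norm.pow 2)
  · have h1 : x * (β - x) ≤ β ^ 2 := by nlinarith [hx.1, hx.2]
    have h2 := bh_chi hx
    have h3 := hM n x hx
    have h4 := norm_nonneg (p n x)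
    have h5 : (x * (β - x)) * ‖p n x‖ ≤ β ^ 2 * M := mul_le_mul h1 h3 h4 (by positivity)
    have := mul_le_mul_of_nonneg_right h5 (mul_nonneg h2 h4)
    calc _ = x * (β - x) * ‖p n x‖ * (x * (β - x) * ‖p n x‖) := by ring
      _ ≤ _ := this

lemma BhS.of_T2 {β L : ℝ} (hβ : 0 < β) (hL : β ≤ L) {u : ℕ → ℝ → ℂ}
    (hu : BhT2 L u) : BhS β u := by
  have hsub : uIcc 0 β ⊆ uIcc 0 L := by
    rw [uIcc_of_le hβ.le, uIcc_of_le (hβ.le.trans hL)]; exact Icc_subset_Icc le_rfl hL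
  have hi : ∀ n, IntervalIntegrable (u n) volume 0 β := fun n => (hu.1 n).1.mono_set hsub
  have hi2 : ∀ n, IntervalIntegrable (fun x => ‖u n x‖ ^ 2) volume 0 β :=
    fun n => (hu.1 n).2.mono_set hsub
  have hlim := ((hu.2.const_mul β).sqrt).const_mul (β ^ 2)
  simp only [mul_zero, Real.sqrt_zero] at hlim
  refine BhS.of_le hβ.le hi hlim fun n => ?_
  have h1 : ∫ x in (0:ℝ)..β, (x * (β - x)) * ‖u n x‖ ≤ β ^ 2 * ∫ x in (0:ℝ)..β, ‖u n x‖ := by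
    rw [← intervalIntegral.integral_const_mul]
    refine intervalIntegral.integral_mono_on hβ.le (bh_wint (hi n).norm)
      ((hi n).norm.const_mul _) fun x hx => ?_
    refine mul_le_mul_of_nonneg_right ?_ (norm_nonneg _)
    nlinarith [hx.1, hx.2]
  refine h1.trans (mul_le_mul_of_nonneg_left ?_ (by positivity))
  refine Real.le_sqrt_of_sq_le ?_
  refine (bh_csq hβ (hi n).norm (hi2 n)).trans (mul_le_mul_of_nonneg_left ?_ hβ.le)
  exact intervalIntegral.integral_mono_interval le_rfl hβ.le hL
    (Eventually.of_forall fun x => by simp) (hu.1 n).2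

/-- the multiplier lemma -/
lemma bh_mult {β : ℝ} (hβ : 0 ≤ β) {Φ A B : ℕ → ℝ → ℂ}
    (hc : ∀ n, ContinuousOn (Φ n) (Icc 0 β))
    (hd : ∀ n, ∀ x ∈ Ioo 0 β, HasDerivAt (Φ n) (A n x + B n x) x)
    (hA : ∀ n, IntervalIntegrable (A n) volume 0 β) (hΦ : BhS β Φ) (hB : BhS β B) :
    Tendsto (fun n => ∫ x in (0:ℝ)..β, (((x * (β - x)) ^ 2 : ℝ) : ℂ) * A n x) atTop (nhds 0) := by
  rw [tendsto_zero_iff_norm_tendsto_zero]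
  have hlim := (hΦ.2.const_mul (2 * β)).add (hB.2.const_mul (β ^ 2))
  simp only [mul_zero, add_zero] at hlim
  refine squeeze_zero (fun n => norm_nonneg _) (fun n => ?_) hlim
  have hw : ∀ {u : ℝ → ℂ} (w : ℝ → ℝ), Continuous w → IntervalIntegrable u volume 0 β →
      IntervalIntegrable (fun x => ((w x : ℝ) : ℂ) * u x) volume 0 β := fun w hw h =>
    h.continuousOn_mul (Continuous.continuousOn (by fun_prop))
  have i1 := hw (fun x => (x * (β - x)) ^ 2) (by fun_prop) (hA n)
  have i2 := hw (fun x => (x * (β - x)) ^ 2) (by fun_prop) (hB.1 n)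
  have i3 := hw (fun x => 2 * (x * (β - x)) * (β - 2 * x)) (by fun_prop) (hΦ.1 n)
  have h0 := integral_eq_of_hasDerivAt_off_countable_of_le
    (fun x => (((x * (β - x)) ^ 2 : ℝ) : ℂ) * Φ n x)
    (fun x => ((2 * (x * (β - x)) * (β - 2 * x) : ℝ) : ℂ) * Φ n x +
      ((((x * (β - x)) ^ 2 : ℝ) : ℂ) * A n x + (((x * (β - x)) ^ 2 : ℝ) : ℂ) * B n x))
    hβ (s := ∅) countable_empty ?_ ?_ (i3.add (i1.add i2))
  · rw [intervalIntegral.integral_add i3 (i1.add i2), intervalIntegral.integral_add i1 i2] at h0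
    have h1 : ∫ x in (0:ℝ)..β, (((x * (β - x)) ^ 2 : ℝ) : ℂ) * A n x =
        -(∫ x in (0:ℝ)..β, ((2 * (x * (β - x)) * (β - 2 * x) : ℝ) : ℂ) * Φ n x)
        - ∫ x in (0:ℝ)..β, (((x * (β - x)) ^ 2 : ℝ) : ℂ) * B n x := by
      have : (fun x => (((x * (β - x)) ^ 2 : ℝ) : ℂ) * Φ n x) β
        - (fun x => (((x * (β - x)) ^ 2 : ℝ) : ℂ) * Φ n x) 0 = 0 := by simp
      rw [this] at h0
      linear_combination h0
    rw [h1]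
    refine (norm_sub_le _ _).trans ?_
    rw [norm_neg]
    refine add_le_add ?_ ?_
    · refine (intervalIntegral.norm_integral_le_integral_norm hβ).trans ?_
      rw [← intervalIntegral.integral_const_mul]
      refine intervalIntegral.integral_mono_on hβ i3.norm
        ((bh_wint (hΦ.1 n).norm).const_mul _) fun x hx => ?_
      rw [norm_mul, Complex.norm_real, Real.norm_eq_abs, abs_mul,
        abs_of_nonneg (mul_nonneg zero_le_two (bh_chi hx))]
      have h2 : |β - 2 * x| ≤ β := abs_le.2 ⟨by linarith [hx.2], by linarith [hx.1]⟩
      have h3 := mul_nonneg (bh_chi hx) (norm_nonneg (Φ n x))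
      nlinarith [mul_le_mul_of_nonneg_right h2 h3]
    · refine (intervalIntegral.norm_integral_le_integral_norm hβ).trans ?_
      rw [← intervalIntegral.integral_const_mul]
      refine intervalIntegral.integral_mono_on hβ i2.norm
        ((bh_wint (hB.1 n).norm).const_mul _) fun x hx => ?_
      rw [norm_mul, Complex.norm_real, Real.norm_eq_abs, abs_of_nonneg (sq_nonneg _)]
      have h2 : x * (β - x) ≤ β ^ 2 := by nlinarith [hx.1, hx.2]
      have h3 := mul_nonneg (bh_chi hx) (norm_nonneg (B n x))
      nlinarith [mul_le_mul_of_nonneg_right h2 h3]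
  · exact ContinuousOn.mul (Continuous.continuousOn (by fun_prop)) (hc n)
  · rintro x ⟨hx, -⟩
    have h2 : HasDerivAt (fun x : ℝ => (x * (β - x)) ^ 2) (2 * (x * (β - x)) * (β - 2 * x)) x := by
      have := (((hasDerivAt_id x).mul ((hasDerivAt_id x).const_sub β)).pow 2)
      refine this.congr_deriv ?_
      simp only [Pi.mul_apply, id_eq, Nat.cast_ofNat]; ring
    refine (h2.ofReal_comp.mul (hd n x hx)).congr_deriv ?_
    ring


/-- first-order form of a wave equation with remainders `r`, `s` -/
structure BhOsc (k ρ lam L β : ℝ) (p q r s : ℝ → ℂ) : Prop where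
  cp : ContinuousOn p (Icc 0 L)
  cq : ContinuousOn q (Icc 0 L)
  dp : ∀ x ∈ Ioo 0 L, x ≠ β → HasDerivAt p ((Complex.I * lam * ρ * q x + r x) / k) x
  dq : ∀ x ∈ Ioo 0 L, x ≠ β → HasDerivAt q (Complex.I * lam * p x + s x) x

lemma bh_osc_energy {k ρ lam L β : ℝ} (hk : 0 < k) {p q r s : ℝ → ℂ}
    (h : BhOsc k ρ lam L β p q r s) {x : ℝ} (hx : x ∈ Ioo 0 L) (hxb : x ≠ β) :
    HasDerivAt (fun t => k * ‖p t‖ ^ 2 + ρ * ‖q t‖ ^ 2)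
      (2 * ((r x * conj (p x)).re + ρ * (s x * conj (q x)).re)) x := by
  have h1 := (bh_normsq_deriv (h.dp x hx hxb)).const_mul k
  have h2 := (bh_normsq_deriv (h.dq x hx hxb)).const_mul ρ
  refine (h1.add h2).congr_deriv ?_
  have hk' : (k : ℂ) ≠ 0 := by exact_mod_cast hk.ne'
  have e1 : (k : ℂ) * ((Complex.I * lam * ρ * q x + r x) / k * conj (p x))
      = Complex.I * lam * ρ * q x * conj (p x) + r x * conj (p x) := by
    field_simp
  have e1' := congrArg Complex.re e1
  rw [Complex.re_ofReal_mul] at e1'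
  have e2 : k * (2 * ((Complex.I * lam * ρ * q x + r x) / k * conj (p x)).re)
      = 2 * (Complex.I * lam * ρ * q x * conj (p x) + r x * conj (p x)).re := by
    rw [← e1']; ring
  rw [e2]
  simp
  ring

lemma bh_osc_cross {k ρ lam L β : ℝ} (hk : 0 < k) {p q r s P Q R T : ℝ → ℂ}
    (h : BhOsc k ρ lam L β p q r s) (H : BhOsc k ρ lam L β P Q R T)
    {x : ℝ} (hx : x ∈ Ioo 0 L) (hxb : x ≠ β) :
    HasDerivAt (fun t => k * (p t * conj (P t)) + ρ * (q t * conj (Q t)))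
      (r x * conj (P x) + p x * conj (R x) + ρ * (s x * conj (Q x) + q x * conj (T x))) x := by
  have hP : HasDerivAt (fun t => conj (P t)) (conj ((Complex.I * lam * ρ * Q x + R x) / k)) x :=
    (H.dp x hx hxb).star
  have hQ : HasDerivAt (fun t => conj (Q t)) (conj (Complex.I * lam * P x + T x)) x :=
    (H.dq x hx hxb).star
  refine ((((h.dp x hx hxb).mul hP).const_mul (k : ℂ)).add
    (((h.dq x hx hxb).mul hQ).const_mul (ρ : ℂ))).congr_deriv ?_
  have hk' : (k : ℂ) ≠ 0 := by exact_mod_cast hk.ne'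
  simp only [map_div₀, map_add, map_mul, Complex.conj_I, Complex.conj_ofReal]
  field_simp
  ring

lemma bh_osc_equi {k ρ lam L β : ℝ} (hk : 0 < k) (hlam : lam ≠ 0) {p q r s : ℝ → ℂ}
    (h : BhOsc k ρ lam L β p q r s)
    {x : ℝ} (hx : x ∈ Ioo 0 L) (hxb : x ≠ β) :
    HasDerivAt (fun t => (lam : ℂ)⁻¹ * (k * (p t * conj (q t))))
      (Complex.I * ((ρ * ‖q x‖ ^ 2 - k * ‖p x‖ ^ 2 : ℝ) : ℂ)
        + (lam : ℂ)⁻¹ * (r x * conj (q x) + k * (p x * conj (s x)))) x := by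
  have hQ : HasDerivAt (fun t => conj (q t)) (conj (Complex.I * lam * p x + s x)) x :=
    (h.dq x hx hxb).star
  refine ((((h.dp x hx hxb).mul hQ).const_mul (k : ℂ)).const_mul (lam : ℂ)⁻¹).congr_deriv ?_
  have hk' : (k : ℂ) ≠ 0 := by exact_mod_cast hk.ne'
  have hl' : (lam : ℂ) ≠ 0 := by exact_mod_cast hlam
  have e1 : ((‖q x‖ : ℂ)) ^ 2 = q x * conj (q x) := (Complex.mul_conj' _).symm
  have e2 : ((‖p x‖ : ℂ)) ^ 2 = p x * conj (p x) := (Complex.mul_conj' _).symm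
  push_cast
  rw [e1, e2]
  simp only [map_add, map_mul, Complex.conj_I, Complex.conj_ofReal]
  field_simp
  ring

section seq
variable {k ρ L β : ℝ} {lam : ℕ → ℝ}

/-- equipartition of energy, in the weighted limit -/
lemma bh_equi_seq (hk : 0 < k) (hβ : 0 < β) (hβL : β < L) (hlam : ∀ n, lam n ≠ 0)
    (hlim : Tendsto (fun n => |lam n|) atTop atTop)
    {p q r s : ℕ → ℝ → ℂ} (h : ∀ n, BhOsc k ρ (lam n) L β (p n) (q n) (r n) (s n))
    (hp : BhB β p) (hq : BhB β q)
    (hr : BhS β (fun n x => ((lam n : ℂ))⁻¹ * r n x)) (hs : BhS β s) :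
    Tendsto (fun n => ∫ x in (0:ℝ)..β, (x * (β - x)) ^ 2 * (ρ * ‖q n x‖ ^ 2 - k * ‖p n x‖ ^ 2))
      atTop (nhds 0) := by
  have hB : BhS β (fun n x => (lam n : ℂ)⁻¹ *
      (r n x * conj (q n x) + k * (p n x * conj (s n x)))) := by
    have h1 := BhS.mul hβ.le hq.conj hr
    have h2 := BhS.mul hβ.le (BhB.inv hlim) (BhS.mul hβ.le ((BhB.const (k : ℂ)).mul hp) hs.conj)
    refine (BhS.add hβ.le h1 h2).congr fun n x => ?_
    ring
  have hΦ : BhS β (fun n x => (lam n : ℂ)⁻¹ * (k * (p n x * conj (q n x)))) :=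
    BhB.inv_mul hβ.le hlim ((BhB.const (k : ℂ)).mul (hp.mul hq.conj))
  have hcΦ : BhB β (fun n x => (lam n : ℂ)⁻¹ * (k * (p n x * conj (q n x)))) :=
    (BhB.inv hlim).mul ((BhB.const (k : ℂ)).mul (hp.mul hq.conj))
  have hcA : ∀ n, ContinuousOn (fun x => ρ * ‖q n x‖ ^ 2 - k * ‖p n x‖ ^ 2) (Icc 0 β) := fun n =>
    (((hq.1 n).norm.pow 2).const_mul ρ).sub (((hp.1 n).norm.pow 2).const_mul k)
  have := bh_mult hβ.le (A := fun n x =>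
      Complex.I * ((ρ * ‖q n x‖ ^ 2 - k * ‖p n x‖ ^ 2 : ℝ) : ℂ)) hcΦ.1
    (fun n x hx => bh_osc_equi hk (hlam n) (h n) ⟨hx.1, hx.2.trans hβL⟩ hx.2.ne)
    (fun n => (continuousOn_const.mul
      (Complex.continuous_ofReal.comp_continuousOn (hcA n))).intervalIntegrable_of_Icc hβ.le)
    hΦ hB
  have h2 := this.norm
  rw [norm_zero] at h2
  refine tendsto_zero_iff_norm_tendsto_zero.2 (h2.congr fun n => ?_)
  have e : ∀ x : ℝ, (((x * (β - x)) ^ 2 : ℝ) : ℂ) *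
      (Complex.I * ((ρ * ‖q n x‖ ^ 2 - k * ‖p n x‖ ^ 2 : ℝ) : ℂ)) =
      Complex.I * (((x * (β - x)) ^ 2 * (ρ * ‖q n x‖ ^ 2 - k * ‖p n x‖ ^ 2) : ℝ) : ℂ) := by
    intro x; push_cast; ring
  simp_rw [e]
  rw [intervalIntegral.integral_const_mul, intervalIntegral.integral_ofReal, norm_mul,
    Complex.norm_I, one_mul, Complex.norm_real]

lemma bh_wint2 (hβ : 0 < β) {p : ℕ → ℝ → ℂ} (hp : BhB β p) (n : ℕ) :
    IntervalIntegrable (fun x => (x * (β - x)) ^ 2 * ‖p n x‖ ^ 2) volume 0 β :=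
  (ContinuousOn.mul (by fun_prop) ((hp.1 n).norm.pow 2)).intervalIntegrable_of_Icc hβ.le

lemma bh_equi_split (hβ : 0 < β) {p q : ℕ → ℝ → ℂ} (hp : BhB β p) (hq : BhB β q) (n : ℕ) :
    ∫ x in (0:ℝ)..β, (x * (β - x)) ^ 2 * (ρ * ‖q n x‖ ^ 2 - k * ‖p n x‖ ^ 2)
      = ρ * (∫ x in (0:ℝ)..β, (x * (β - x)) ^ 2 * ‖q n x‖ ^ 2)
        - k * ∫ x in (0:ℝ)..β, (x * (β - x)) ^ 2 * ‖p n x‖ ^ 2 := by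
  rw [← intervalIntegral.integral_const_mul, ← intervalIntegral.integral_const_mul,
    ← intervalIntegral.integral_sub ((bh_wint2 hβ hq n).const_mul ρ)
      ((bh_wint2 hβ hp n).const_mul k)]
  congr 1
  funext x; ring

lemma bh_equi_pq (hk : 0 < k) (hβ : 0 < β) (hβL : β < L) (hlam : ∀ n, lam n ≠ 0)
    (hlim : Tendsto (fun n => |lam n|) atTop atTop)
    {p q r s : ℕ → ℝ → ℂ} (h : ∀ n, BhOsc k ρ (lam n) L β (p n) (q n) (r n) (s n))
    (hp : BhB β p) (hq : BhB β q)
    (hr : BhS β (fun n x => ((lam n : ℂ))⁻¹ * r n x)) (hs : BhS β s) (hqs : BhS β q) :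
    BhS β p := by
  have h1 := bh_equi_seq hk hβ hβL hlam hlim h hp hq hr hs
  have h2 := BhS.sq hβ.le hq hqs
  refine BhS.of_sq hβ hp.1 ?_
  have h3 := ((h2.const_mul ρ).sub h1).const_mul k⁻¹
  simp only [mul_zero, sub_zero] at h3
  refine h3.congr fun n => ?_
  rw [bh_equi_split hβ hp hq]
  field_simp
  ring

lemma bh_equi_qp (hk : 0 < k) (hρ : 0 < ρ) (hβ : 0 < β) (hβL : β < L) (hlam : ∀ n, lam n ≠ 0)
    (hlim : Tendsto (fun n => |lam n|) atTop atTop)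
    {p q r s : ℕ → ℝ → ℂ} (h : ∀ n, BhOsc k ρ (lam n) L β (p n) (q n) (r n) (s n))
    (hp : BhB β p) (hq : BhB β q)
    (hr : BhS β (fun n x => ((lam n : ℂ))⁻¹ * r n x)) (hs : BhS β s) (hps : BhS β p) :
    BhS β q := by
  have h1 := bh_equi_seq hk hβ hβL hlam hlim h hp hq hr hs
  have h2 := BhS.sq hβ.le hp hps
  refine BhS.of_sq hβ hq.1 ?_
  have h3 := ((h2.const_mul k).add h1).const_mul ρ⁻¹
  simp only [mul_zero, add_zero] at h3
  refine h3.congr fun n => ?_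
  rw [bh_equi_split hβ hp hq]
  field_simp
  ring

/-- cross multiplier: if `r P̄ + p R̄` equals `c |u|²` up to small terms and `p, q` are small,
then `u` is small -/
lemma bh_cross_seq (hk : 0 < k) (hβ : 0 < β) (hβL : β < L)
    {p q r s P Q R T u B : ℕ → ℝ → ℂ} {c : ℝ} (hc : c ≠ 0)
    (h : ∀ n, BhOsc k ρ (lam n) L β (p n) (q n) (r n) (s n))
    (H : ∀ n, BhOsc k ρ (lam n) L β (P n) (Q n) (R n) (T n))
    (hP : BhB β P) (hQ : BhB β Q) (hp : BhS β p) (hq : BhS β q) (hqb : BhB β q)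
    (hs : BhS β s) (hT : BhS β T) (hu : BhB β u) (hB : BhS β B)
    (hr : ∀ n x, r n x * conj (P n x) + p n x * conj (R n x)
      = (c : ℂ) * (u n x * conj (u n x)) + B n x) :
    BhS β u := by
  have hΦ : BhS β (fun n t => k * (p n t * conj (P n t)) + ρ * (q n t * conj (Q n t))) := by
    refine (BhS.add hβ.le (BhS.mul hβ.le ((BhB.const (k : ℂ)).mul hP.conj) hp)
      (BhS.mul hβ.le ((BhB.const (ρ : ℂ)).mul hQ.conj) hq)).congr fun n x => ?_
    ring
  have hB' : BhS β (fun n x => B n x + ρ * (s n x * conj (Q n x) + q n x * conj (T n x))) := by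
    refine (BhS.add hβ.le hB (BhS.add hβ.le (BhS.mul hβ.le ((BhB.const (ρ : ℂ)).mul hQ.conj) hs)
      (BhS.mul hβ.le ((BhB.const (ρ : ℂ)).mul hqb) hT.conj))).congr fun n x => ?_
    ring
  have hsub : Icc 0 β ⊆ Icc 0 L := Icc_subset_Icc le_rfl hβL.le
  have hcs : ∀ {f : ℝ → ℂ}, ContinuousOn f (Icc 0 L) →
      ContinuousOn (fun x => conj (f x)) (Icc 0 β) := fun hf =>
    Complex.continuous_conj.comp_continuousOn (hf.mono hsub)
  have hA : BhB β (fun n x => (c : ℂ) * (u n x * conj (u n x))) :=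
    (BhB.const (c : ℂ)).mul (hu.mul hu.conj)
  have := bh_mult hβ.le
    (Φ := fun n t => k * (p n t * conj (P n t)) + ρ * (q n t * conj (Q n t)))
    (A := fun n x => (c : ℂ) * (u n x * conj (u n x)))
    (B := fun n x => B n x + ρ * (s n x * conj (Q n x) + q n x * conj (T n x)))
    (fun n => (continuousOn_const.mul (((h n).cp.mono hsub).mul (hcs (H n).cp))).add
      (continuousOn_const.mul (((h n).cq.mono hsub).mul (hcs (H n).cq))))
    (fun n x hx => by
      have := bh_osc_cross hk (h n) (H n) ⟨hx.1, hx.2.trans hβL⟩ hx.2.ne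
      rw [hr n x] at this
      simpa only [add_assoc] using this)
    (hA.int hβ.le) hΦ hB'
  have h2 := this.norm.const_mul |c|⁻¹
  rw [norm_zero, mul_zero] at h2
  refine BhS.of_sq hβ hu.1 (h2.congr fun n => ?_)
  have e : ∀ x : ℝ, (((x * (β - x)) ^ 2 : ℝ) : ℂ) * ((c : ℂ) * (u n x * conj (u n x))) =
      (c : ℂ) * (((x * (β - x)) ^ 2 * ‖u n x‖ ^ 2 : ℝ) : ℂ) := by
    intro x; rw [Complex.mul_conj']; push_cast; ring
  simp_rw [e]
  rw [intervalIntegral.integral_const_mul, intervalIntegral.integral_ofReal, norm_mul,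
    Complex.norm_real, Complex.norm_real, Real.norm_eq_abs, Real.norm_eq_abs,
    abs_of_nonneg (intervalIntegral.integral_nonneg hβ.le fun x hx => by positivity)]
  have : |c| ≠ 0 := abs_ne_zero.2 hc
  field_simp

end seq


lemma bh_young {m a1 a3 a5 b1 b3 b5 r1 r3 r5 g1 g3 g5 t1 t3 t5 k ρ : ℝ}
    (hk : 0 < k) (hρ : 0 < ρ) (hm : 0 ≤ m)
    (h1 : 0 ≤ a1) (h3 : 0 ≤ a3) (h5 : 0 ≤ a5)
    (hr1 : r1 ≤ m * (a1 + a3 + a5) + g1) (hr3 : r3 ≤ m * (a1 + a3 + a5) + g3)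
    (hr5 : r5 ≤ m * (a1 + a3 + a5) + g5) :
    2 * (r1 * a1 + ρ * (t1 * b1)) + 2 * (r3 * a3 + ρ * (t3 * b3)) + 2 * (r5 * a5 + ρ * (t5 * b5))
    ≤ ((6 * m + 1) / k + 1) * ((k * a1 ^ 2 + ρ * b1 ^ 2) + (k * a3 ^ 2 + ρ * b3 ^ 2)
      + (k * a5 ^ 2 + ρ * b5 ^ 2))
      + (g1 ^ 2 + g3 ^ 2 + g5 ^ 2 + ρ * (t1 ^ 2 + t3 ^ 2 + t5 ^ 2)) := by
  have yy : ∀ t b : ℝ, ρ * (t * b) * 2 ≤ ρ * t ^ 2 + ρ * b ^ 2 := fun t b => by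
    have := mul_nonneg hρ.le (sq_nonneg (t - b))
    linarith
  have zz : ∀ g a : ℝ, 2 * (g * a) ≤ g ^ 2 + a ^ 2 := fun g a => by
    have := sq_nonneg (g - a)
    linarith
  have e1 := mul_le_mul_of_nonneg_right hr1 h1
  have e3 := mul_le_mul_of_nonneg_right hr3 h3
  have e5 := mul_le_mul_of_nonneg_right hr5 h5
  have s : (a1 + a3 + a5) ^ 2 ≤ 3 * (a1 ^ 2 + a3 ^ 2 + a5 ^ 2) := by
    nlinarith [sq_nonneg (a1 - a3), sq_nonneg (a1 - a5), sq_nonneg (a3 - a5)]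
  have s' := mul_le_mul_of_nonneg_left s hm
  have hX : 0 ≤ (6 * m + 1) / k := by positivity
  have hXk : (6 * m + 1) / k * k = 6 * m + 1 := by field_simp
  have y1 := yy t1 b1
  have z1 := zz g1 a1
  have y3 := yy t3 b3
  have z3 := zz g3 a3
  have y5 := yy t5 b5
  have z5 := zz g5 a5
  have hrest : 0 ≤ (6 * m + 1) / k * (ρ * b1 ^ 2 + ρ * b3 ^ 2 + ρ * b5 ^ 2) := by positivity
  have hrest2 : 0 ≤ k * a1 ^ 2 + k * a3 ^ 2 + k * a5 ^ 2 := by positivity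
  have hexp : ((6 * m + 1) / k + 1) * ((k * a1 ^ 2 + ρ * b1 ^ 2) + (k * a3 ^ 2 + ρ * b3 ^ 2)
      + (k * a5 ^ 2 + ρ * b5 ^ 2)) = ((6 * m + 1) / k * k) * (a1 ^ 2 + a3 ^ 2 + a5 ^ 2)
      + (6 * m + 1) / k * (ρ * b1 ^ 2 + ρ * b3 ^ 2 + ρ * b5 ^ 2)
      + (k * a1 ^ 2 + k * a3 ^ 2 + k * a5 ^ 2) + (ρ * b1 ^ 2 + ρ * b3 ^ 2 + ρ * b5 ^ 2) := by
    ring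
  rw [hexp, hXk]
  linarith

lemma bh_re_le (u w : ℂ) : |(u * conj w).re| ≤ ‖u‖ * ‖w‖ := by
  have := Complex.abs_re_le_norm (u * conj w)
  simpa using this

theorem bh_core {k ρ c l L β : ℝ} (hk : 0 < k) (hρ : 0 < ρ) (hc : 0 < c) (hl : 0 < l)
    (hβ : 0 < β) (hβL : β < L) {lam : ℕ → ℝ} (hlam : ∀ n, lam n ≠ 0)
    (hlim : Tendsto (fun n => |lam n|) atTop atTop)
    {p1 q1 s1 g1 p3 q3 s3 g3 p5 q5 s5 g5 : ℕ → ℝ → ℂ}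
    (h1 : ∀ n, BhOsc k ρ (lam n) L β (p1 n) (q1 n)
      (fun x => (-(k : ℂ)) * p3 n x + (-(2 * k * l : ℂ)) * p5 n x + g1 n x) (s1 n))
    (h3 : ∀ n, BhOsc k ρ (lam n) L β (p3 n) (q3 n) (fun x => (c : ℂ) * p1 n x + g3 n x) (s3 n))
    (h5 : ∀ n, BhOsc k ρ (lam n) L β (p5 n) (q5 n)
      (fun x => (2 * k * l : ℂ) * p1 n x + g5 n x) (s5 n))
    (hg1 : BhT2 L g1) (hg3 : BhT2 L g3) (hg5 : BhT2 L g5)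
    (hs1 : BhT2 L s1) (hs3 : BhT2 L s3) (hs5 : BhT2 L s5)
    (M : ℝ) (hM : ∀ n, ∫ x in (0:ℝ)..L, ((k * ‖p1 n x‖ ^ 2 + ρ * ‖q1 n x‖ ^ 2)
      + (k * ‖p3 n x‖ ^ 2 + ρ * ‖q3 n x‖ ^ 2) + (k * ‖p5 n x‖ ^ 2 + ρ * ‖q5 n x‖ ^ 2)) ≤ M)
    (hq5 : BhS β q5) :
    ∃ δ : ℕ → ℝ, Tendsto δ atTop (nhds 0) ∧ ∀ n, ∀ x ∈ Icc 0 L,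
      (k * ‖p1 n x‖ ^ 2 + ρ * ‖q1 n x‖ ^ 2)
      + (k * ‖p3 n x‖ ^ 2 + ρ * ‖q3 n x‖ ^ 2) + (k * ‖p5 n x‖ ^ 2 + ρ * ‖q5 n x‖ ^ 2) ≤ δ n := by
  have hL : 0 < L := hβ.trans hβL
  set E : ℕ → ℝ → ℝ := fun n x => (k * ‖p1 n x‖ ^ 2 + ρ * ‖q1 n x‖ ^ 2)
      + (k * ‖p3 n x‖ ^ 2 + ρ * ‖q3 n x‖ ^ 2) + (k * ‖p5 n x‖ ^ 2 + ρ * ‖q5 n x‖ ^ 2) with hEdef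
  set R : ℕ → ℝ → ℝ := fun n x => ‖g1 n x‖ ^ 2 + ‖g3 n x‖ ^ 2 + ‖g5 n x‖ ^ 2
      + ρ * (‖s1 n x‖ ^ 2 + ‖s3 n x‖ ^ 2 + ‖s5 n x‖ ^ 2) with hRdef
  set m : ℝ := k + 2 * k * l + c with hm
  have hm0 : 0 ≤ m := by positivity
  set K : ℝ := Real.exp (((6 * m + 1) / k + 1) * L) with hK
  have hK0 : 0 < K := Real.exp_pos _
  have hE0 : ∀ n x, 0 ≤ E n x := fun n x => by simp only [hEdef]; positivity
  have hEc : ∀ n, ContinuousOn (E n) (Icc 0 L) := fun n => by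
    have a1 := (h1 n).cp; have a2 := (h1 n).cq; have a3 := (h3 n).cp
    have a4 := (h3 n).cq; have a5 := (h5 n).cp; have a6 := (h5 n).cq
    simp only [hEdef]
    fun_prop
  have hRi : ∀ n, IntervalIntegrable (R n) volume 0 L := fun n =>
    (((hg1.1 n).2.add (hg3.1 n).2).add (hg5.1 n).2).add
      ((((hs1.1 n).2.add (hs3.1 n).2).add (hs5.1 n).2).const_mul ρ)
  have hRlim : Tendsto (fun n => ∫ x in (0:ℝ)..L, R n x) atTop (nhds 0) := by
    have := ((hg1.2.add hg3.2).add hg5.2).add (((hs1.2.add hs3.2).add hs5.2).const_mul ρ)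
    simp only [add_zero, mul_zero] at this
    refine this.congr fun n => ?_
    simp only [hRdef]
    rw [intervalIntegral.integral_add (((hg1.1 n).2.add (hg3.1 n).2).add (hg5.1 n).2)
      ((((hs1.1 n).2.add (hs3.1 n).2).add (hs5.1 n).2).const_mul ρ),
      intervalIntegral.integral_add ((hg1.1 n).2.add (hg3.1 n).2) (hg5.1 n).2,
      intervalIntegral.integral_add (hg1.1 n).2 (hg3.1 n).2,
      intervalIntegral.integral_const_mul,
      intervalIntegral.integral_add ((hs1.1 n).2.add (hs3.1 n).2) (hs5.1 n).2,
      intervalIntegral.integral_add (hs1.1 n).2 (hs3.1 n).2]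
  -- Gronwall
  have hG : ∀ n, ∀ x ∈ Icc 0 L, ∀ y ∈ Icc 0 L, E n x ≤ K * (E n y + ∫ t in (0:ℝ)..L, R n t) := by
    intro n
    have ip1 := BhL2.of_cont hL.le (h1 n).cp
    have iq1 := BhL2.of_cont hL.le (h1 n).cq
    have ip3 := BhL2.of_cont hL.le (h3 n).cp
    have iq3 := BhL2.of_cont hL.le (h3 n).cq
    have ip5 := BhL2.of_cont hL.le (h5 n).cp
    have iq5 := BhL2.of_cont hL.le (h5 n).cq
    have ir1 := ((ip3.const_mul (-(k : ℂ))).add (ip5.const_mul (-(2 * k * l : ℂ)))).add (hg1.1 n)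
    have ir3 := (ip1.const_mul (c : ℂ)).add (hg3.1 n)
    have ir5 := (ip1.const_mul (2 * k * l : ℂ)).add (hg5.1 n)
    have nk : ‖(k : ℂ)‖ = k := by simp [abs_of_pos hk]
    have nc : ‖(c : ℂ)‖ = c := by simp [abs_of_pos hc]
    have nkl : ‖(2 * k * l : ℂ)‖ = 2 * k * l := by simp [abs_of_pos hk, abs_of_pos hl]
    refine bh_gronwall (L := L) (β := β) (C0 := (6 * m + 1) / k + 1) (by positivity) (E n)
      (fun x => 2 * (((( -(k : ℂ)) * p3 n x + (-(2 * k * l : ℂ)) * p5 n x + g1 n x)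
          * conj (p1 n x)).re + ρ * (s1 n x * conj (q1 n x)).re)
        + 2 * ((((c : ℂ) * p1 n x + g3 n x) * conj (p3 n x)).re
            + ρ * (s3 n x * conj (q3 n x)).re)
        + 2 * ((((2 * k * l : ℂ) * p1 n x + g5 n x) * conj (p5 n x)).re
            + ρ * (s5 n x * conj (q5 n x)).re))
      (R n) (hEc n) ?_ ?_ (hRi n) (fun x => by simp only [hRdef]; positivity) ?_ (hE0 n)
    · intro x hx hxb
      exact ((bh_osc_energy hk (h1 n) hx hxb).add (bh_osc_energy hk (h3 n) hx hxb)).add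
        (bh_osc_energy hk (h5 n) hx hxb)
    · exact ((((bh_re_int (ir1.mul ip1)).add
          ((bh_re_int ((hs1.1 n).mul iq1)).const_mul ρ)).const_mul 2).add
        (((bh_re_int (ir3.mul ip3)).add
          ((bh_re_int ((hs3.1 n).mul iq3)).const_mul ρ)).const_mul 2)).add
        (((bh_re_int (ir5.mul ip5)).add
          ((bh_re_int ((hs5.1 n).mul iq5)).const_mul ρ)).const_mul 2)
    · intro x
      have kl0 : 0 ≤ 2 * k * l := by positivity
      have n1 := norm_nonneg (p1 n x)
      have n3 := norm_nonneg (p3 n x)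
      have n5 := norm_nonneg (p5 n x)
      have hy := bh_young (m := m) (b1 := ‖q1 n x‖) (b3 := ‖q3 n x‖) (b5 := ‖q5 n x‖)
        (r1 := ‖(-(k : ℂ)) * p3 n x + (-(2 * k * l : ℂ)) * p5 n x + g1 n x‖)
        (r3 := ‖(c : ℂ) * p1 n x + g3 n x‖)
        (r5 := ‖(2 * k * l : ℂ) * p1 n x + g5 n x‖)
        (g1 := ‖g1 n x‖) (g3 := ‖g3 n x‖) (g5 := ‖g5 n x‖)
        (t1 := ‖s1 n x‖) (t3 := ‖s3 n x‖) (t5 := ‖s5 n x‖) hk hρ hm0 n1 n3 n5 (by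
          refine (norm_add_le _ _).trans ?_
          have := norm_add_le ((-(k : ℂ)) * p3 n x) ((-(2 * k * l : ℂ)) * p5 n x)
          rw [norm_mul, norm_mul, norm_neg, norm_neg, nk, nkl] at this
          rw [hm]
          nlinarith [mul_nonneg hk.le n1, mul_nonneg hk.le n5, mul_nonneg kl0 n1,
            mul_nonneg kl0 n3, mul_nonneg hc.le n1, mul_nonneg hc.le n3, mul_nonneg hc.le n5])
        (by
          refine (norm_add_le _ _).trans ?_
          rw [norm_mul, nc, hm]
          nlinarith [mul_nonneg hk.le n1, mul_nonneg hk.le n3, mul_nonneg hk.le n5,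
            mul_nonneg kl0 n1, mul_nonneg kl0 n5,
            mul_nonneg kl0 n3, mul_nonneg hc.le n3, mul_nonneg hc.le n5])
        (by
          refine (norm_add_le _ _).trans ?_
          rw [norm_mul, nkl, hm]
          nlinarith [mul_nonneg hk.le n1, mul_nonneg hk.le n3, mul_nonneg hk.le n5,
            mul_nonneg kl0 n3, mul_nonneg kl0 n5,
            mul_nonneg hc.le n1, mul_nonneg hc.le n3, mul_nonneg hc.le n5])
      refine le_trans ?_ hy
      have b1 := abs_le.1 (bh_re_le ((-(k : ℂ)) * p3 n x + (-(2 * k * l : ℂ)) * p5 n x + g1 n x)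
        (p1 n x))
      have b3 := abs_le.1 (bh_re_le ((c : ℂ) * p1 n x + g3 n x) (p3 n x))
      have b5 := abs_le.1 (bh_re_le ((2 * k * l : ℂ) * p1 n x + g5 n x) (p5 n x))
      have d1 := abs_le.1 (bh_re_le (s1 n x) (q1 n x))
      have d3 := abs_le.1 (bh_re_le (s3 n x) (q3 n x))
      have d5 := abs_le.1 (bh_re_le (s5 n x) (q5 n x))
      have f1 := mul_le_mul_of_nonneg_left d1.1 hρ.le
      have f2 := mul_le_mul_of_nonneg_left d1.2 hρ.le
      have f3 := mul_le_mul_of_nonneg_left d3.1 hρ.le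
      have f4 := mul_le_mul_of_nonneg_left d3.2 hρ.le
      have f5 := mul_le_mul_of_nonneg_left d5.1 hρ.le
      have f6 := mul_le_mul_of_nonneg_left d5.2 hρ.le
      rw [abs_le]
      constructor <;> linarith [b1.1, b1.2, b3.1, b3.2, b5.1, b5.2]
  -- averaged Gronwall
  have hav : ∀ (w : ℝ → ℝ) (b : ℝ), 0 ≤ b → b ≤ L → Continuous w → (∀ x, 0 ≤ w x) → ∀ n,
      ∀ x ∈ Icc 0 L, E n x * (∫ y in (0:ℝ)..b, w y) ≤
        K * ((∫ y in (0:ℝ)..b, w y * E n y)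
          + (∫ t in (0:ℝ)..L, R n t) * ∫ y in (0:ℝ)..b, w y) := by
    intro w b hb0 hbL hw hw0 n x hx
    have iw : IntervalIntegrable w volume 0 b := hw.intervalIntegrable _ _
    have iwE : IntervalIntegrable (fun y => w y * E n y) volume 0 b :=
      (hw.continuousOn.mul ((hEc n).mono (Icc_subset_Icc le_rfl hbL))).intervalIntegrable_of_Icc hb0
    rw [← intervalIntegral.integral_const_mul, ← intervalIntegral.integral_const_mul,
      ← intervalIntegral.integral_add iwE (iw.const_mul _), ← intervalIntegral.integral_const_mul]
    refine intervalIntegral.integral_mono_on hb0 (iw.const_mul _)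
      ((iwE.add (iw.const_mul _)).const_mul _) fun y hy => ?_
    have := mul_le_mul_of_nonneg_right (hG n x hx y ⟨hy.1, hy.2.trans hbL⟩) (hw0 y)
    calc _ ≤ _ := this
      _ = _ := by ring
  obtain ⟨R0, hR0⟩ := hRlim.bddAbove_range
  have hEb : ∀ n, ∀ x ∈ Icc 0 L, E n x ≤ K * (M + R0 * L) / L := by
    intro n x hx
    have := hav (fun _ => 1) L hL.le le_rfl continuous_const (fun _ => zero_le_one) n x hx
    simp only [intervalIntegral.integral_const, sub_zero, smul_eq_mul, mul_one, one_mul] at this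
    rw [le_div_iff₀ hL]
    refine this.trans (mul_le_mul_of_nonneg_left ?_ hK0.le)
    exact add_le_add (hM n) (mul_le_mul_of_nonneg_right (hR0 ⟨n, rfl⟩) hL.le)
  set MM := K * (M + R0 * L) / L with hMM
  have hsub : Icc 0 β ⊆ Icc 0 L := Icc_subset_Icc le_rfl hβL.le
  have mkB : ∀ {u : ℕ → ℝ → ℂ} {d : ℝ}, 0 < d → (∀ n, ContinuousOn (u n) (Icc 0 L)) →
      (∀ n x, d * ‖u n x‖ ^ 2 ≤ E n x) → BhB β u := by
    intro u d hd hu hle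
    refine ⟨fun n => (hu n).mono hsub, Real.sqrt (MM / d), fun n x hx => ?_⟩
    refine Real.le_sqrt_of_sq_le ?_
    rw [le_div_iff₀ hd]
    linarith [hle n x, hEb n x (hsub hx)]
  have bp1 : BhB β p1 := mkB hk (fun n => (h1 n).cp) fun n x => by
    have : 0 ≤ ρ * ‖q1 n x‖ ^ 2 + (k * ‖p3 n x‖ ^ 2 + ρ * ‖q3 n x‖ ^ 2)
      + (k * ‖p5 n x‖ ^ 2 + ρ * ‖q5 n x‖ ^ 2) := by positivity
    simp only [hEdef]; linarith
  have bq1 : BhB β q1 := mkB hρ (fun n => (h1 n).cq) fun n x => by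
    have : 0 ≤ k * ‖p1 n x‖ ^ 2 + (k * ‖p3 n x‖ ^ 2 + ρ * ‖q3 n x‖ ^ 2)
      + (k * ‖p5 n x‖ ^ 2 + ρ * ‖q5 n x‖ ^ 2) := by positivity
    simp only [hEdef]; linarith
  have bp3 : BhB β p3 := mkB hk (fun n => (h3 n).cp) fun n x => by
    have : 0 ≤ (k * ‖p1 n x‖ ^ 2 + ρ * ‖q1 n x‖ ^ 2) + (ρ * ‖q3 n x‖ ^ 2)
      + (k * ‖p5 n x‖ ^ 2 + ρ * ‖q5 n x‖ ^ 2) := by positivity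
    simp only [hEdef]; linarith
  have bq3 : BhB β q3 := mkB hρ (fun n => (h3 n).cq) fun n x => by
    have : 0 ≤ (k * ‖p1 n x‖ ^ 2 + ρ * ‖q1 n x‖ ^ 2) + (k * ‖p3 n x‖ ^ 2)
      + (k * ‖p5 n x‖ ^ 2 + ρ * ‖q5 n x‖ ^ 2) := by positivity
    simp only [hEdef]; linarith
  have bp5 : BhB β p5 := mkB hk (fun n => (h5 n).cp) fun n x => by
    have : 0 ≤ (k * ‖p1 n x‖ ^ 2 + ρ * ‖q1 n x‖ ^ 2) + (k * ‖p3 n x‖ ^ 2 + ρ * ‖q3 n x‖ ^ 2)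
      + (ρ * ‖q5 n x‖ ^ 2) := by positivity
    simp only [hEdef]; linarith
  have bq5 : BhB β q5 := mkB hρ (fun n => (h5 n).cq) fun n x => by
    have : 0 ≤ (k * ‖p1 n x‖ ^ 2 + ρ * ‖q1 n x‖ ^ 2) + (k * ‖p3 n x‖ ^ 2 + ρ * ‖q3 n x‖ ^ 2)
      + (k * ‖p5 n x‖ ^ 2) := by positivity
    simp only [hEdef]; linarith
  have Sg1 := BhS.of_T2 hβ hβL.le hg1
  have Sg3 := BhS.of_T2 hβ hβL.le hg3
  have Sg5 := BhS.of_T2 hβ hβL.le hg5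
  have Ss1 := BhS.of_T2 hβ hβL.le hs1
  have Ss3 := BhS.of_T2 hβ hβL.le hs3
  have Ss5 := BhS.of_T2 hβ hβL.le hs5
  have hb := hβ.le
  have inv_r : ∀ {w g : ℕ → ℝ → ℂ}, BhB β w → BhS β g →
      BhS β (fun n x => ((lam n : ℂ))⁻¹ * (w n x + g n x)) := by
    intro w g hw hg
    refine (BhS.add hb (BhB.inv_mul hb hlim hw) (BhS.mul hb (BhB.inv hlim) hg)).congr
      fun n x => ?_
    ring
  have r1 := inv_r (((BhB.const (-(k : ℂ))).mul bp3).add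
    ((BhB.const (-(2 * k * l : ℂ))).mul bp5)) Sg1
  have r3 := inv_r ((BhB.const (c : ℂ)).mul bp1) Sg3
  have r5 := inv_r ((BhB.const (2 * k * l : ℂ)).mul bp1) Sg5
  have Sp5 : BhS β p5 := bh_equi_pq hk hβ hβL hlam hlim h5 bp5 bq5 r5 Ss5 hq5
  have Sp1 : BhS β p1 := by
    refine bh_cross_seq (c := 2 * k * l) hk hβ hβL (by positivity) h5 h1 bp1 bq1 Sp5 hq5 bq5
      Ss5 Ss1 bp1 (B := fun n x => conj (p1 n x) * g5 n x
        + ((-(k : ℂ)) * conj (p3 n x) * p5 n x + ((-(2 * k * l : ℂ)) * conj (p5 n x) * p5 n x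
        + p5 n x * conj (g1 n x)))) ?_ ?_
    · exact BhS.add hb (BhS.mul hb bp1.conj Sg5) (BhS.add hb
        (BhS.mul hb ((BhB.const _).mul bp3.conj) Sp5) (BhS.add hb
        (BhS.mul hb ((BhB.const _).mul bp5.conj) Sp5) (BhS.mul hb bp5 Sg1.conj)))
    · intro n x
      simp only [map_add, map_mul, map_neg, Complex.conj_ofReal, map_ofNat]
      push_cast
      ring
  have Sq1 : BhS β q1 := bh_equi_qp hk hρ hβ hβL hlam hlim h1 bp1 bq1 r1 Ss1 Sp1
  have Sp3 : BhS β p3 := by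
    refine bh_cross_seq (c := -k) hk hβ hβL (by simpa using hk.ne') h1 h3 bp3 bq3 Sp1 Sq1 bq1
      Ss1 Ss3 bp3 (B := fun n x => (-(2 * k * l : ℂ)) * conj (p3 n x) * p5 n x
        + (conj (p3 n x) * g1 n x + ((c : ℂ) * conj (p1 n x) * p1 n x
        + p1 n x * conj (g3 n x)))) ?_ ?_
    · exact BhS.add hb (BhS.mul hb ((BhB.const _).mul bp3.conj) Sp5)
        (BhS.add hb (BhS.mul hb bp3.conj Sg1) (BhS.add hb
        (BhS.mul hb ((BhB.const _).mul bp1.conj) Sp1) (BhS.mul hb bp1 Sg3.conj)))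
    · intro n x
      simp only [map_add, map_mul, Complex.conj_ofReal]
      push_cast
      ring
  have Sq3 : BhS β q3 := bh_equi_qp hk hρ hβ hβL hlam hlim h3 bp3 bq3 r3 Ss3 Sp3
  -- conclusion
  have hloc : Tendsto (fun n => ∫ x in (0:ℝ)..β, (x * (β - x)) ^ 2 * E n x) atTop (nhds 0) := by
    have := ((((BhS.sq hb bp1 Sp1).const_mul k).add ((BhS.sq hb bq1 Sq1).const_mul ρ)).add
      (((BhS.sq hb bp3 Sp3).const_mul k).add ((BhS.sq hb bq3 Sq3).const_mul ρ))).add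
      (((BhS.sq hb bp5 Sp5).const_mul k).add ((BhS.sq hb bq5 hq5).const_mul ρ))
    simp only [mul_zero, add_zero] at this
    refine this.congr fun n => ?_
    have i1 := (bh_wint2 hβ bp1 n).const_mul k
    have i2 := (bh_wint2 hβ bq1 n).const_mul ρ
    have i3 := (bh_wint2 hβ bp3 n).const_mul k
    have i4 := (bh_wint2 hβ bq3 n).const_mul ρ
    have i5 := (bh_wint2 hβ bp5 n).const_mul k
    have i6 := (bh_wint2 hβ bq5 n).const_mul ρ
    simp only [← intervalIntegral.integral_const_mul]
    rw [← intervalIntegral.integral_add i1 i2, ← intervalIntegral.integral_add i3 i4,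
      ← intervalIntegral.integral_add i5 i6,
      ← intervalIntegral.integral_add (i1.add i2) (i3.add i4),
      ← intervalIntegral.integral_add ((i1.add i2).add (i3.add i4)) (i5.add i6)]
    congr 1
    funext x
    simp only [hEdef]
    ring
  have hW : 0 < ∫ y in (0:ℝ)..β, (y * (β - y)) ^ 2 := by
    refine intervalIntegral.intervalIntegral_pos_of_pos_on
      (Continuous.intervalIntegrable (by fun_prop) _ _) (fun x hx => ?_) hβ
    have h1 : 0 < x := hx.1
    have h2 : 0 < β - x := by linarith [hx.2]
    positivity
  set W := ∫ y in (0:ℝ)..β, (y * (β - y)) ^ 2 with hWdef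
  refine ⟨fun n => K * ((∫ x in (0:ℝ)..β, (x * (β - x)) ^ 2 * E n x)
    + (∫ t in (0:ℝ)..L, R n t) * W) / W, ?_, fun n x hx => ?_⟩
  · have := ((hloc.add (hRlim.mul_const W)).const_mul K).div_const W
    simpa using this
  · rw [le_div_iff₀ hW]
    exact hav (fun y => (y * (β - y)) ^ 2) β hb hβL.le (by fun_prop) (fun x => sq_nonneg _) n x hx


/-- the energy density -/
def bhN (k k2 ρ1 ρ2 l : ℝ) (w1 w3 w5 W1 W3 W5 z1 z3 z5 : ℝ → ℂ) (x : ℝ) : ℝ :=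
  k * ‖W1 x + w3 x + (l : ℂ) * w5 x‖ ^ 2 + ρ1 * ‖z1 x‖ ^ 2
    + k2 * ‖W3 x‖ ^ 2 + ρ2 * ‖z3 x‖ ^ 2
    + k * ‖W5 x - (l : ℂ) * w1 x‖ ^ 2 + ρ1 * ‖z5 x‖ ^ 2

/-- cleaned-up resolvent system at fixed index -/
structure BhClean (k k2 ρ1 ρ2 l L β a0 lam : ℝ)
    (v1 v3 v5 p1 p3 p5 q1 q3 q5 f1 f3 f5 G1 G3 G5 f2 f4 f6 : ℝ → ℂ) : Prop where
  cv1 : ContinuousOn v1 (Icc 0 L)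
  cv3 : ContinuousOn v3 (Icc 0 L)
  cv5 : ContinuousOn v5 (Icc 0 L)
  cp1 : ContinuousOn p1 (Icc 0 L)
  cp3 : ContinuousOn p3 (Icc 0 L)
  cp5 : ContinuousOn p5 (Icc 0 L)
  cq1 : ContinuousOn q1 (Icc 0 L)
  cq3 : ContinuousOn q3 (Icc 0 L)
  cq5 : ContinuousOn q5 (Icc 0 L)
  cf1 : ContinuousOn f1 (Icc 0 L)
  cf3 : ContinuousOn f3 (Icc 0 L)
  cf5 : ContinuousOn f5 (Icc 0 L)
  cG1 : ContinuousOn G1 (Icc 0 L)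
  cG3 : ContinuousOn G3 (Icc 0 L)
  cG5 : ContinuousOn G5 (Icc 0 L)
  cf2 : ContinuousOn f2 (Icc 0 L)
  cf4 : ContinuousOn f4 (Icc 0 L)
  cf6 : ContinuousOn f6 (Icc 0 L)
  dv1 : ∀ x ∈ Ioo 0 L, HasDerivAt v1 (p1 x) x
  dv3 : ∀ x ∈ Ioo 0 L, HasDerivAt v3 (p3 x) x
  dv5 : ∀ x ∈ Ioo 0 L, HasDerivAt v5 (p5 x) x
  df1 : ∀ x ∈ Ioo 0 L, HasDerivAt f1 (G1 x) x
  df3 : ∀ x ∈ Ioo 0 L, HasDerivAt f3 (G3 x) x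
  df5 : ∀ x ∈ Ioo 0 L, HasDerivAt f5 (G5 x) x
  e1 : ∀ x ∈ Icc 0 L, Complex.I * lam * v1 x - f1 x = q1 x
  e3 : ∀ x ∈ Icc 0 L, Complex.I * lam * v3 x - f3 x = q3 x
  e5 : ∀ x ∈ Icc 0 L, Complex.I * lam * v5 x - f5 x = q5 x
  dp1 : ∀ x ∈ Ioo 0 L, x ≠ β → HasDerivAt p1 ((Complex.I * lam * ρ1 * q1 x
    - k * p3 x - k * l * p5 x - l * k * (p5 x - l * v1 x) - ρ1 * f2 x) / k) x
  dp3 : ∀ x ∈ Ioo 0 L, x ≠ β → HasDerivAt p3 ((Complex.I * lam * ρ2 * q3 x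
    + k * (p1 x + v3 x + l * v5 x) - ρ2 * f4 x) / k2) x
  dp5 : ∀ x ∈ Ioo 0 L, x ≠ β → HasDerivAt p5 ((Complex.I * lam * ρ1 * q5 x
    + k * l * p1 x + l * k * (p1 x + v3 x + l * v5 x) + (if x < β then (a0 : ℂ) else 0) * q5 x
    - ρ1 * f6 x) / k) x
  bv : v1 0 = 0 ∧ v3 0 = 0 ∧ v5 0 = 0
  bf : f1 0 = 0 ∧ f3 0 = 0 ∧ f5 0 = 0
  bq0 : q1 0 = 0 ∧ q3 0 = 0 ∧ q5 0 = 0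
  bqL : q1 L = 0 ∧ q3 L = 0 ∧ q5 L = 0

lemma bh_reg1 {L : ℝ} (hL : 0 < L) {u : ℝ → ℂ} (h : ContDiffOn ℝ 1 u (Icc 0 L)) :
    ContinuousOn (derivWithin u (Icc 0 L)) (Icc 0 L) ∧
    (∀ x ∈ Ioo 0 L, HasDerivAt u (derivWithin u (Icc 0 L) x) x) ∧
    (∀ x ∈ Ioo 0 L, deriv u x = derivWithin u (Icc 0 L) x) := by
  have hn : ∀ x ∈ Ioo 0 L, Icc 0 L ∈ nhds x := fun x hx => Icc_mem_nhds hx.1 hx.2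
  refine ⟨h.continuousOn_derivWithin (uniqueDiffOn_Icc hL) le_rfl, fun x hx => ?_, fun x hx => ?_⟩
  · exact ((h.differentiableOn one_ne_zero).hasDerivAt (hn x hx)).congr_deriv
      (derivWithin_of_mem_nhds (hn x hx)).symm
  · exact (derivWithin_of_mem_nhds (hn x hx)).symm

lemma bh_reg2 {L x : ℝ} {u : ℝ → ℂ} (hx : x ∈ Ioo 0 L) (h : ContDiffAt ℝ 2 u x) :
    HasDerivAt (derivWithin u (Icc 0 L)) (deriv (deriv u) x) x ∧
    HasDerivAt (deriv u) (deriv (deriv u) x) x := by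
  have h1 : ContDiffAt ℝ 1 (deriv u) x := h.derivWithin (by norm_num)
  have h2 : HasDerivAt (deriv u) (deriv (deriv u) x) x :=
    (h1.differentiableAt one_ne_zero).hasDerivAt
  refine ⟨h2.congr_of_eventuallyEq ?_, h2⟩
  filter_upwards [isOpen_Ioo.mem_nhds hx] with y hy
  exact derivWithin_of_mem_nhds (Icc_mem_nhds hy.1 hy.2)

lemma bh_ext {L β : ℝ} (hβ : 0 < β) (hβL : β < L) {f g : ℝ → ℂ}
    (hf : ContinuousOn f (Icc 0 L)) (hg : ContinuousOn g (Icc 0 L))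
    (h : ∀ x ∈ Ioo 0 β ∪ Ioo β L, f x = g x) : ∀ x ∈ Icc 0 L, f x = g x := by
  refine Set.EqOn.of_subset_closure (s := Ioo 0 β ∪ Ioo β L) h hf hg ?_ ?_
  · exact union_subset (Ioo_subset_Icc_self.trans (Icc_subset_Icc le_rfl hβL.le))
      (Ioo_subset_Icc_self.trans (Icc_subset_Icc hβ.le le_rfl))
  · rw [closure_union, closure_Ioo hβ.ne, closure_Ioo hβL.ne]
    exact Icc_subset_Icc_union_Icc

lemma bh_clean {ρ₁ ρ₂ k₁ k₂ l L β a₀ : ℝ} (hk1 : 0 < k₁) (hk2 : 0 < k₂)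
    (hL : 0 < L) (hbeta : 0 < β) (hbetaL : β < L)
    (S : BresseSetting ρ₁ ρ₂ k₁ k₂ k₁ l L β a₀ 0) (n : ℕ) :
    BhClean k₁ k₂ ρ₁ ρ₂ l L β a₀ (S.lam n) (S.v1 n) (S.v3 n) (S.v5 n)
      (derivWithin (S.v1 n) (Icc 0 L)) (derivWithin (S.v3 n) (Icc 0 L))
      (derivWithin (S.v5 n) (Icc 0 L)) (S.v2 n) (S.v4 n) (S.v6 n)
      (S.f1 n) (S.f3 n) (S.f5 n)
      (derivWithin (S.f1 n) (Icc 0 L)) (derivWithin (S.f3 n) (Icc 0 L))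
      (derivWithin (S.f5 n) (Icc 0 L)) (S.f2 n) (S.f4 n) (S.f6 n) := by
  have r1 := bh_reg1 hL ((S.reg_v1 n).of_le one_le_two)
  have r3 := bh_reg1 hL ((S.reg_v3 n).of_le one_le_two)
  have r5 := bh_reg1 hL (S.reg_v5 n)
  have s1 := bh_reg1 hL (S.reg_f1 n)
  have s3 := bh_reg1 hL (S.reg_f3 n)
  have s5 := bh_reg1 hL (S.reg_f5 n)
  have hmem : ∀ x ∈ Ioo 0 L, x ≠ β → x ∈ Ioo 0 β ∪ Ioo β L := fun x hx hxb => by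
    rcases lt_or_gt_of_ne hxb with h | h
    · exact Or.inl ⟨hx.1, h⟩
    · exact Or.inr ⟨h, hx.2⟩
  have cI : ∀ {u f : ℝ → ℂ}, ContinuousOn u (Icc 0 L) → ContinuousOn f (Icc 0 L) →
      ContinuousOn (fun x => Complex.I * (S.lam n : ℂ) * u x - f x) (Icc 0 L) := fun hu hf =>
    (continuousOn_const.mul hu).sub hf
  have c2 : ∀ x ∈ Ioo 0 L, x ≠ β → ContDiffAt ℝ 2 (S.v1 n) x ∧ ContDiffAt ℝ 2 (S.v3 n) x ∧
      ContDiffAt ℝ 2 (S.v5 n) x := by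
    intro x hx hxb
    refine ⟨(S.reg_v1 n).contDiffAt (Icc_mem_nhds hx.1 hx.2),
      (S.reg_v3 n).contDiffAt (Icc_mem_nhds hx.1 hx.2), ?_⟩
    rcases lt_or_gt_of_ne hxb with h | h
    · exact (S.reg_v5_left n).contDiffAt (Icc_mem_nhds hx.1 h)
    · exact (S.reg_v5_right n).contDiffAt (Icc_mem_nhds h hx.2)
  have hk1' : (k₁ : ℂ) ≠ 0 := by exact_mod_cast hk1.ne'
  have hk2' : (k₂ : ℂ) ≠ 0 := by exact_mod_cast hk2.ne'
  obtain ⟨z1, z2, z3, z4, z5, z6, z7, z8, z9⟩ := S.bc_zero n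
  obtain ⟨y1, y2, y3, y4, y5, y6, y7, y8, y9⟩ := S.bc_L n
  refine
  { cv1 := (S.reg_v1 n).continuousOn
    cv3 := (S.reg_v3 n).continuousOn
    cv5 := (S.reg_v5 n).continuousOn
    cp1 := r1.1
    cp3 := r3.1
    cp5 := r5.1
    cq1 := (S.reg_v2 n).continuousOn
    cq3 := (S.reg_v4 n).continuousOn
    cq5 := (S.reg_v6 n).continuousOn
    cf1 := (S.reg_f1 n).continuousOn
    cf3 := (S.reg_f3 n).continuousOn
    cf5 := (S.reg_f5 n).continuousOn
    cG1 := s1.1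
    cG3 := s3.1
    cG5 := s5.1
    cf2 := S.reg_f2 n
    cf4 := S.reg_f4 n
    cf6 := S.reg_f6 n
    dv1 := r1.2.1
    dv3 := r3.2.1
    dv5 := r5.2.1
    df1 := s1.2.1
    df3 := s3.2.1
    df5 := s5.2.1
    e1 := ?_
    e3 := ?_
    e5 := ?_
    dp1 := ?_
    dp3 := ?_
    dp5 := ?_
    bv := ⟨z1, z3, z5⟩
    bf := ⟨z7, z8, z9⟩
    bq0 := ⟨z2, z4, z6⟩
    bqL := ⟨y2, y4, y6⟩ }
  · refine bh_ext hbeta hbetaL (cI (S.reg_v1 n).continuousOn (S.reg_f1 n).continuousOn)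
      (S.reg_v2 n).continuousOn fun x hx => ?_
    have := S.eq1 n x hx
    simp only [Nat.cast_zero, neg_zero, zpow_zero, one_mul] at this
    linear_combination this
  · refine bh_ext hbeta hbetaL (cI (S.reg_v3 n).continuousOn (S.reg_f3 n).continuousOn)
      (S.reg_v4 n).continuousOn fun x hx => ?_
    have := S.eq3 n x hx
    simp only [Nat.cast_zero, neg_zero, zpow_zero, one_mul] at this
    linear_combination this
  · refine bh_ext hbeta hbetaL (cI (S.reg_v5 n).continuousOn (S.reg_f5 n).continuousOn)
      (S.reg_v6 n).continuousOn fun x hx => ?_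
    have := S.eq5 n x hx
    simp only [Nat.cast_zero, neg_zero, zpow_zero, one_mul] at this
    linear_combination this
  · intro x hx hxb
    have h1 := bh_reg2 hx (c2 x hx hxb).1
    have hS := ((h1.2.add (r3.2.1 x hx)).add ((r5.2.1 x hx).const_mul (l : ℂ))).deriv
    have := S.eq2 n x (hmem x hx hxb)
    simp only [Nat.cast_zero, neg_zero, zpow_zero, mul_one] at this
    have hS' : deriv (fun y => deriv (S.v1 n) y + S.v3 n y + (l : ℂ) * S.v5 n y) x = _ := hS
    rw [hS', r5.2.2 x hx] at this
    refine h1.1.congr_deriv ?_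
    rw [eq_div_iff hk1']
    linear_combination -this
  · intro x hx hxb
    have h1 := bh_reg2 hx (c2 x hx hxb).2.1
    have := S.eq4 n x (hmem x hx hxb)
    simp only [Nat.cast_zero, neg_zero, zpow_zero, mul_one] at this
    rw [r1.2.2 x hx] at this
    refine h1.1.congr_deriv ?_
    rw [eq_div_iff hk2']
    linear_combination -this
  · intro x hx hxb
    have h1 := bh_reg2 hx (c2 x hx hxb).2.2
    have hS := (h1.2.sub ((r1.2.1 x hx).const_mul (l : ℂ))).deriv
    have := S.eq6 n x (hmem x hx hxb)
    simp only [Nat.cast_zero, neg_zero, zpow_zero, mul_one] at this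
    have hS' : deriv (fun y => deriv (S.v5 n) y - (l : ℂ) * S.v1 n y) x = _ := hS
    rw [hS', r1.2.2 x hx] at this
    refine h1.1.congr_deriv ?_
    rw [eq_div_iff hk1']
    linear_combination -this

/-- zero-order bound -/
lemma bh_h1 {l L : ℝ} (hl : 0 < l) (hL : 0 < L) {u1 u3 u5 P1 P3 P5 : ℝ → ℂ}
    (c1 : ContinuousOn u1 (Icc 0 L)) (c3 : ContinuousOn u3 (Icc 0 L))
    (c5 : ContinuousOn u5 (Icc 0 L)) (C1 : ContinuousOn P1 (Icc 0 L))
    (C3 : ContinuousOn P3 (Icc 0 L)) (C5 : ContinuousOn P5 (Icc 0 L))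
    (d1 : ∀ x ∈ Ioo 0 L, HasDerivAt u1 (P1 x) x) (d3 : ∀ x ∈ Ioo 0 L, HasDerivAt u3 (P3 x) x)
    (d5 : ∀ x ∈ Ioo 0 L, HasDerivAt u5 (P5 x) x) (b : u1 0 = 0 ∧ u3 0 = 0 ∧ u5 0 = 0) :
    ∀ x ∈ Icc 0 L, ‖u1 x‖ ^ 2 + ‖u3 x‖ ^ 2 + ‖u5 x‖ ^ 2 ≤ Real.exp ((2 + 2 * l) * L) *
      ∫ t in (0:ℝ)..L, (‖P1 t + u3 t + (l : ℂ) * u5 t‖ ^ 2 + ‖P3 t‖ ^ 2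
        + ‖P5 t - (l : ℂ) * u1 t‖ ^ 2) := by
  intro x hx
  have := bh_gronwall (L := L) (β := L) (C0 := 2 + 2 * l) (by positivity)
    (fun t => ‖u1 t‖ ^ 2 + ‖u3 t‖ ^ 2 + ‖u5 t‖ ^ 2)
    (fun t => 2 * (P1 t * conj (u1 t)).re + 2 * (P3 t * conj (u3 t)).re
      + 2 * (P5 t * conj (u5 t)).re)
    (fun t => ‖P1 t + u3 t + (l : ℂ) * u5 t‖ ^ 2 + ‖P3 t‖ ^ 2
        + ‖P5 t - (l : ℂ) * u1 t‖ ^ 2) (by fun_prop)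
    (fun t ht _ => ((bh_normsq_deriv (d1 t ht)).add (bh_normsq_deriv (d3 t ht))).add
      (bh_normsq_deriv (d5 t ht)))
    ((((bh_re_int ((BhL2.of_cont hL.le C1).mul (BhL2.of_cont hL.le c1))).const_mul 2).add
      ((bh_re_int ((BhL2.of_cont hL.le C3).mul (BhL2.of_cont hL.le c3))).const_mul 2)).add
      ((bh_re_int ((BhL2.of_cont hL.le C5).mul (BhL2.of_cont hL.le c5))).const_mul 2))
    (ContinuousOn.intervalIntegrable_of_Icc hL.le (by fun_prop))
    (fun t => by positivity) (fun t => ?_) (fun t => by positivity) x hx 0 ⟨le_rfl, hL.le⟩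
  · simpa [b.1, b.2.1, b.2.2] using this
  · set A := P1 t + u3 t + (l : ℂ) * u5 t with hA
    set N := P5 t - (l : ℂ) * u1 t with hN
    have e1 : P1 t = A - u3 t - (l : ℂ) * u5 t := by rw [hA]; ring
    have e5 : P5 t = N + (l : ℂ) * u1 t := by rw [hN]; ring
    have nl : ‖(l : ℂ)‖ = l := by simp [abs_of_pos hl]
    have n1 : ‖P1 t‖ ≤ ‖A‖ + ‖u3 t‖ + l * ‖u5 t‖ := by
      rw [e1]
      refine (norm_sub_le _ _).trans (add_le_add (norm_sub_le _ _) ?_)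
      rw [norm_mul, nl]
    have n5 : ‖P5 t‖ ≤ ‖N‖ + l * ‖u1 t‖ := by
      rw [e5]
      refine (norm_add_le _ _).trans (add_le_add le_rfl ?_)
      rw [norm_mul, nl]
    have x1 := abs_le.1 (bh_re_le (P1 t) (u1 t))
    have x3 := abs_le.1 (bh_re_le (P3 t) (u3 t))
    have x5 := abs_le.1 (bh_re_le (P5 t) (u5 t))
    have m1 := mul_le_mul_of_nonneg_right n1 (norm_nonneg (u1 t))
    have m5 := mul_le_mul_of_nonneg_right n5 (norm_nonneg (u5 t))
    have zz : ∀ g a : ℝ, 2 * (g * a) ≤ g ^ 2 + a ^ 2 := fun g a => by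
      have := sq_nonneg (g - a)
      linarith
    have w1 := zz ‖A‖ ‖u1 t‖
    have w2 := zz ‖u3 t‖ ‖u1 t‖
    have w3 := mul_le_mul_of_nonneg_left (zz ‖u5 t‖ ‖u1 t‖) hl.le
    have w4 := zz ‖P3 t‖ ‖u3 t‖
    have w5 := zz ‖N‖ ‖u5 t‖
    have w6 := mul_nonneg hl.le (sq_nonneg ‖u3 t‖)
    have key : 2 * (‖P1 t‖ * ‖u1 t‖) + 2 * (‖P3 t‖ * ‖u3 t‖) + 2 * (‖P5 t‖ * ‖u5 t‖)
        ≤ (2 + 2 * l) * (‖u1 t‖ ^ 2 + ‖u3 t‖ ^ 2 + ‖u5 t‖ ^ 2)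
          + (‖A‖ ^ 2 + ‖P3 t‖ ^ 2 + ‖N‖ ^ 2) := by
      have v3 := sq_nonneg ‖u3 t‖
      have v5 := sq_nonneg ‖u5 t‖
      linarith
    rw [abs_le]
    constructor <;> linarith [x1.1, x1.2, x3.1, x3.2, x5.1, x5.2]

lemma bh_damp_L2 {L β a0 : ℝ} {u : ℝ → ℂ} (hu : BhL2 L u) :
    BhL2 L (fun x => (if x < β then (a0 : ℂ) else 0) * u x) := by
  have hm : Measurable (fun x : ℝ => if x < β then (a0 : ℂ) else 0) :=
    Measurable.ite measurableSet_Iio measurable_const measurable_const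
  have hb : ∀ x : ℝ, ‖(if x < β then (a0 : ℂ) else 0)‖ ≤ |a0| := fun x => by
    split_ifs <;> simp
  refine ⟨(hu.1.norm.const_mul |a0|).mono_fun' ?_ ?_, (hu.2.const_mul (|a0| ^ 2)).mono_fun' ?_ ?_⟩
  · exact hm.aestronglyMeasurable.mul hu.1.aestronglyMeasurable_restrict_uIoc
  · refine Eventually.of_forall fun x => ?_
    simp only [norm_mul]
    exact mul_le_mul_of_nonneg_right (hb x) (norm_nonneg _)
  · exact (hm.aestronglyMeasurable.mul hu.1.aestronglyMeasurable_restrict_uIoc).norm.pow 2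
  · refine Eventually.of_forall fun x => ?_
    simp only [norm_mul, norm_pow, norm_norm, mul_pow]
    exact mul_le_mul_of_nonneg_right (pow_le_pow_left₀ (norm_nonneg _) (hb x) 2) (by positivity)

lemma bh_young2 {t : ℝ} (ht : 0 < t) (u w : ℂ) :
    (u * conj w).re ≤ 1 / 2 * (t * ‖u‖ ^ 2 + t⁻¹ * ‖w‖ ^ 2) := by
  have h1 := (abs_le.1 (bh_re_le u w)).2
  have h2 : ‖u‖ * ‖w‖ ≤ 1 / 2 * (t * ‖u‖ ^ 2 + t⁻¹ * ‖w‖ ^ 2) := by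
    have := mul_nonneg ht.le (sq_nonneg (‖u‖ - t⁻¹ * ‖w‖))
    have e : t * (‖u‖ - t⁻¹ * ‖w‖) ^ 2 = t * ‖u‖ ^ 2 + t⁻¹ * ‖w‖ ^ 2 - 2 * (‖u‖ * ‖w‖) := by
      field_simp
      ring
    linarith
  exact h1.trans h2

lemma bh_diss_deriv {k k2 ρ1 ρ2 l L β a0 lam : ℝ} (hk : 0 < k) (hk2 : 0 < k2)
    {v1 v3 v5 p1 p3 p5 q1 q3 q5 f1 f3 f5 G1 G3 G5 f2 f4 f6 : ℝ → ℂ}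
    (C : BhClean k k2 ρ1 ρ2 l L β a0 lam v1 v3 v5 p1 p3 p5 q1 q3 q5 f1 f3 f5 G1 G3 G5 f2 f4 f6)
    {x : ℝ} (hx : x ∈ Ioo 0 L) (hxb : x ≠ β) :
    HasDerivAt (fun x => (k * (p1 x + v3 x + l * v5 x) * conj (q1 x) + k2 * p3 x * conj (q3 x)
      + k * (p5 x - l * v1 x) * conj (q5 x) : ℂ).re)
      ((if x < β then a0 else 0) * ‖q5 x‖ ^ 2
        - (ρ1 * (f2 x * conj (q1 x)).re + ρ2 * (f4 x * conj (q3 x)).re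
          + ρ1 * (f6 x * conj (q5 x)).re
          + k * ((p1 x + v3 x + l * v5 x) * conj (G1 x + f3 x + l * f5 x)).re
          + k2 * (p3 x * conj (G3 x)).re
          + k * ((p5 x - l * v1 x) * conj (G5 x - l * f1 x)).re)) x := by
  have hk' : (k : ℂ) ≠ 0 := by exact_mod_cast hk.ne'
  have hk2' : (k2 : ℂ) ≠ 0 := by exact_mod_cast hk2.ne'
  have hn : Ioo 0 L ∈ nhds x := isOpen_Ioo.mem_nhds hx
  have hq : ∀ {v p q f G : ℝ → ℂ}, (∀ x ∈ Icc 0 L, Complex.I * lam * v x - f x = q x) →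
      HasDerivAt v (p x) x → HasDerivAt f (G x) x →
      HasDerivAt (fun y => conj (q y)) (-(Complex.I * lam * conj (p x)) - conj (G x)) x := by
    intro v p q f G he hv hf
    have h1 := ((hv.const_mul (Complex.I * lam)).sub hf).star
    refine (h1.congr_of_eventuallyEq ?_).congr_deriv ?_
    · filter_upwards [hn] with y hy
      rw [← he y ⟨hy.1.le, hy.2.le⟩]
      rfl
    · change conj _ = _
      simp
  have Q1 := hq C.e1 (C.dv1 x hx) (C.df1 x hx)
  have Q3 := hq C.e3 (C.dv3 x hx) (C.df3 x hx)
  have Q5 := hq C.e5 (C.dv5 x hx) (C.df5 x hx)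
  have P1 := ((((C.dp1 x hx hxb).add (C.dv3 x hx)).add ((C.dv5 x hx).const_mul (l:ℂ))).const_mul
    (k:ℂ)).mul Q1
  have P3 := ((C.dp3 x hx hxb).const_mul (k2:ℂ)).mul Q3
  have P5 := (((C.dp5 x hx hxb).sub ((C.dv1 x hx).const_mul (l:ℂ))).const_mul (k:ℂ)).mul Q5
  have P := (P1.add P3).add P5
  have R := Complex.reCLM.hasFDerivAt.comp_hasDerivAt x P
  refine R.congr_deriv ?_
  have hxc : x ∈ Icc 0 L := ⟨hx.1.le, hx.2.le⟩
  have E1 := congrArg conj (C.e1 x hxc)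
  have E3 := congrArg conj (C.e3 x hxc)
  have E5 := congrArg conj (C.e5 x hxc)
  simp only [map_sub, map_mul, Complex.conj_I, Complex.conj_ofReal] at E1 E3 E5
  have key : ∀ z w : ℂ, ∀ r : ℝ, z = Complex.I * (r : ℂ) + w → Complex.reCLM z = w.re := by
    intro z w r h
    rw [h]; simp
  have hre : ∀ (r : ℝ) (z : ℂ), r * z.re = ((r : ℂ) * z).re := fun r z => by simp
  have hn5 : (if x < β then a0 else 0) * ‖q5 x‖ ^ 2
      = ((if x < β then (a0 : ℂ) else 0) * (q5 x * conj (q5 x))).re := by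
    rw [Complex.mul_conj']
    split_ifs
    · rw [← Complex.ofReal_pow, ← Complex.ofReal_mul, Complex.ofReal_re]
    · simp
  rw [hn5]
  simp only [hre, ← Complex.add_re, ← Complex.sub_re]
  refine key _ _ (lam * (ρ1 * ‖q1 x‖ ^ 2 + ρ2 * ‖q3 x‖ ^ 2 + ρ1 * ‖q5 x‖ ^ 2
    - k * ‖p1 x + v3 x + l * v5 x‖ ^ 2 - k2 * ‖p3 x‖ ^ 2 - k * ‖p5 x - l * v1 x‖ ^ 2)) ?_
  push_cast
  simp only [← Complex.mul_conj', Pi.add_apply, Pi.sub_apply, map_add, map_sub, map_mul,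
    Complex.conj_ofReal]
  generalize (if x < β then (a0 : ℂ) else 0) = A
  field_simp
  linear_combination (-(k:ℂ) * (p1 x + v3 x + l * v5 x)) * (E3 + l * E5)
    + (l * k * (p5 x - l * v1 x)) * E1

lemma bh_diss {k k2 ρ1 ρ2 l L β a0 lam : ℝ} (hk : 0 < k) (hk2 : 0 < k2) (hρ1 : 0 < ρ1)
    (hρ2 : 0 < ρ2) (ha : 0 < a0) (hL : 0 < L)
    {v1 v3 v5 p1 p3 p5 q1 q3 q5 f1 f3 f5 G1 G3 G5 f2 f4 f6 : ℝ → ℂ}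
    (C : BhClean k k2 ρ1 ρ2 l L β a0 lam v1 v3 v5 p1 p3 p5 q1 q3 q5 f1 f3 f5 G1 G3 G5 f2 f4 f6)
    {t : ℝ} (ht : 0 < t) :
    ∫ x in (0:ℝ)..L, ‖(if x < β then (a0 : ℂ) else 0) * q5 x‖ ^ 2
      ≤ a0 / 2 * (t * (∫ x in (0:ℝ)..L, bhN k k2 ρ1 ρ2 l v1 v3 v5 p1 p3 p5 q1 q3 q5 x)
        + t⁻¹ * ∫ x in (0:ℝ)..L, bhN k k2 ρ1 ρ2 l f1 f3 f5 G1 G3 G5 f2 f4 f6 x) := by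
  obtain ⟨cv1, cv3, cv5, cp1, cp3, cp5, cq1, cq3, cq5, cf1, cf3, cf5, cG1, cG3, cG5, cf2, cf4,
    cf6, -, -, -, -, -, -, -, -, -, -, -, -, -, -, bq0, bqL⟩ := id C
  set D : ℝ → ℝ := fun x => (if x < β then a0 else 0) * ‖q5 x‖ ^ 2
        - (ρ1 * (f2 x * conj (q1 x)).re + ρ2 * (f4 x * conj (q3 x)).re
          + ρ1 * (f6 x * conj (q5 x)).re
          + k * ((p1 x + v3 x + l * v5 x) * conj (G1 x + f3 x + l * f5 x)).re
          + k2 * (p3 x * conj (G3 x)).re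
          + k * ((p5 x - l * v1 x) * conj (G5 x - l * f1 x)).re) with hD
  have hdamp := (bh_damp_L2 (β := β) (a0 := a0) (BhL2.of_cont hL.le cq5)).2
  have hpt : ∀ x, ‖(if x < β then (a0 : ℂ) else 0) * q5 x‖ ^ 2
      = a0 * ((if x < β then a0 else 0) * ‖q5 x‖ ^ 2) := fun x => by
    split_ifs
    · rw [norm_mul, mul_pow]; simp; ring
    · simp
  have hdi : IntervalIntegrable (fun x => (if x < β then a0 else 0) * ‖q5 x‖ ^ 2) volume 0 L := by
    refine (hdamp.const_mul a0⁻¹).congr (fun x _ => ?_)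
    simp only [hpt]
    field_simp
  have c0 : ContinuousOn (fun x => ρ1 * (f2 x * conj (q1 x)).re + ρ2 * (f4 x * conj (q3 x)).re
          + ρ1 * (f6 x * conj (q5 x)).re
          + k * ((p1 x + v3 x + l * v5 x) * conj (G1 x + f3 x + l * f5 x)).re
          + k2 * (p3 x * conj (G3 x)).re
          + k * ((p5 x - l * v1 x) * conj (G5 x - l * f1 x)).re) (Icc 0 L) := by
    have cc : ∀ {u : ℝ → ℂ}, ContinuousOn u (Icc 0 L) →
        ContinuousOn (fun x => conj (u x)) (Icc 0 L) := fun h =>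
      Complex.continuous_conj.comp_continuousOn h
    have cr : ∀ {u : ℝ → ℂ}, ContinuousOn u (Icc 0 L) →
        ContinuousOn (fun x => (u x).re) (Icc 0 L) := fun h =>
      Complex.continuous_re.comp_continuousOn h
    have a1 := cr (cf2.mul (cc cq1))
    have a2 := cr (cf4.mul (cc cq3))
    have a3 := cr (cf6.mul (cc cq5))
    have a4 := cr (((cp1.add cv3).add (continuousOn_const (c := (l:ℂ)).mul cv5)).mul
      (cc ((cG1.add cf3).add (continuousOn_const (c := (l:ℂ)).mul cf5))))
    have a5 := cr (cp3.mul (cc cG3))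
    have a6 := cr ((cp5.sub (continuousOn_const (c := (l:ℂ)).mul cv1)).mul
      (cc (cG5.sub (continuousOn_const (c := (l:ℂ)).mul cf1))))
    exact (((((continuousOn_const.mul a1).add (continuousOn_const.mul a2)).add
      (continuousOn_const.mul a3)).add (continuousOn_const.mul a4)).add
      (continuousOn_const.mul a5)).add (continuousOn_const.mul a6)
  have hDi : IntervalIntegrable D volume 0 L := hdi.sub (c0.intervalIntegrable_of_Icc hL.le)
  have hFTC := MeasureTheory.integral_eq_of_hasDerivAt_off_countable_of_le
    (fun x => (k * (p1 x + v3 x + l * v5 x) * conj (q1 x) + k2 * p3 x * conj (q3 x)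
      + k * (p5 x - l * v1 x) * conj (q5 x) : ℂ).re) D hL.le (countable_singleton β)
    (by
      refine Complex.continuous_re.comp_continuousOn ?_
      have cc : ∀ {u : ℝ → ℂ}, ContinuousOn u (Icc 0 L) →
        ContinuousOn (fun x => conj (u x)) (Icc 0 L) := fun h =>
        Complex.continuous_conj.comp_continuousOn h
      have b1 := cc cq1
      have b3 := cc cq3
      have b5 := cc cq5
      fun_prop)
    (fun x hx => bh_diss_deriv hk hk2 C hx.1 (fun h => hx.2 (by simp [h]))) hDi
  simp only [bq0.1, bq0.2.1, bq0.2.2, bqL.1, bqL.2.1, bqL.2.2, map_zero, mul_zero, add_zero,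
    Complex.zero_re, sub_zero] at hFTC
  have iU : IntervalIntegrable (bhN k k2 ρ1 ρ2 l v1 v3 v5 p1 p3 p5 q1 q3 q5) volume 0 L := by
    refine ContinuousOn.intervalIntegrable_of_Icc hL.le ?_
    unfold bhN
    fun_prop
  have iF : IntervalIntegrable (bhN k k2 ρ1 ρ2 l f1 f3 f5 G1 G3 G5 f2 f4 f6) volume 0 L := by
    refine ContinuousOn.intervalIntegrable_of_Icc hL.le ?_
    unfold bhN
    fun_prop
  have hmono : ∫ x in (0:ℝ)..L, ((if x < β then a0 else 0) * ‖q5 x‖ ^ 2)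
      ≤ ∫ x in (0:ℝ)..L, (D x + 1 / 2 * (t * bhN k k2 ρ1 ρ2 l v1 v3 v5 p1 p3 p5 q1 q3 q5 x
        + t⁻¹ * bhN k k2 ρ1 ρ2 l f1 f3 f5 G1 G3 G5 f2 f4 f6 x)) := by
    refine intervalIntegral.integral_mono_on hL.le hdi
      (hDi.add (((iU.const_mul t).add (iF.const_mul t⁻¹)).const_mul (1 / 2))) fun x _ => ?_
    have hti : 0 < t⁻¹ := inv_pos.2 ht
    have y1 := mul_le_mul_of_nonneg_left (bh_young2 hti (f2 x) (q1 x)) hρ1.le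
    have y2 := mul_le_mul_of_nonneg_left (bh_young2 hti (f4 x) (q3 x)) hρ2.le
    have y3 := mul_le_mul_of_nonneg_left (bh_young2 hti (f6 x) (q5 x)) hρ1.le
    have y4 := mul_le_mul_of_nonneg_left
      (bh_young2 ht (p1 x + v3 x + l * v5 x) (G1 x + f3 x + l * f5 x)) hk.le
    have y5 := mul_le_mul_of_nonneg_left (bh_young2 ht (p3 x) (G3 x)) hk2.le
    have y6 := mul_le_mul_of_nonneg_left
      (bh_young2 ht (p5 x - l * v1 x) (G5 x - l * f1 x)) hk.le
    rw [inv_inv] at y1 y2 y3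
    simp only [hD, bhN]
    linarith
  rw [intervalIntegral.integral_add hDi (((iU.const_mul t).add (iF.const_mul t⁻¹)).const_mul _),
    hFTC, intervalIntegral.integral_const_mul,
    intervalIntegral.integral_add (iU.const_mul t) (iF.const_mul t⁻¹),
    intervalIntegral.integral_const_mul, intervalIntegral.integral_const_mul] at hmono
  simp only [hpt]
  rw [intervalIntegral.integral_const_mul]
  have := mul_le_mul_of_nonneg_left hmono ha.le
  linarith

/-- the energy controls everything -/
lemma bh_ctrl {k k2 ρ1 ρ2 l L : ℝ} (hk : 0 < k) (hk2 : 0 < k2) (hρ1 : 0 < ρ1)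
    (hρ2 : 0 < ρ2) (hl : 0 < l) (hL : 0 < L) : ∃ K : ℝ, 0 < K ∧
    ∀ {u1 u3 u5 P1 P3 P5 z1 z3 z5 : ℝ → ℂ},
    ContinuousOn u1 (Icc 0 L) → ContinuousOn u3 (Icc 0 L) → ContinuousOn u5 (Icc 0 L) →
    ContinuousOn P1 (Icc 0 L) → ContinuousOn P3 (Icc 0 L) → ContinuousOn P5 (Icc 0 L) →
    ContinuousOn z1 (Icc 0 L) → ContinuousOn z3 (Icc 0 L) → ContinuousOn z5 (Icc 0 L) →
    (∀ x ∈ Ioo 0 L, HasDerivAt u1 (P1 x) x) → (∀ x ∈ Ioo 0 L, HasDerivAt u3 (P3 x) x) →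
    (∀ x ∈ Ioo 0 L, HasDerivAt u5 (P5 x) x) → (u1 0 = 0 ∧ u3 0 = 0 ∧ u5 0 = 0) →
    (∀ x ∈ Icc 0 L, ‖u1 x‖ ^ 2 + ‖u3 x‖ ^ 2 + ‖u5 x‖ ^ 2 ≤
      K * ∫ t in (0:ℝ)..L, bhN k k2 ρ1 ρ2 l u1 u3 u5 P1 P3 P5 z1 z3 z5 t) ∧
    ∫ x in (0:ℝ)..L, (‖P1 x‖ ^ 2 + ‖P3 x‖ ^ 2 + ‖P5 x‖ ^ 2 + ‖z1 x‖ ^ 2 + ‖z3 x‖ ^ 2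
      + ‖z5 x‖ ^ 2) ≤ K * ∫ t in (0:ℝ)..L, bhN k k2 ρ1 ρ2 l u1 u3 u5 P1 P3 P5 z1 z3 z5 t := by
  set c0 : ℝ := k⁻¹ + k2⁻¹ + ρ1⁻¹ + ρ2⁻¹ with hc0
  set X : ℝ := Real.exp ((2 + 2 * l) * L) with hX
  have hX0 : 0 < X := Real.exp_pos _
  have hc00 : 0 < c0 := by positivity
  have b1 : 1 ≤ c0 * k := by
    have : 0 < (k2⁻¹ + ρ1⁻¹ + ρ2⁻¹) * k := by positivity
    have e : k⁻¹ * k = 1 := inv_mul_cancel₀ hk.ne'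
    rw [hc0]; linarith
  have b2 : 1 ≤ c0 * k2 := by
    have : 0 < (k⁻¹ + ρ1⁻¹ + ρ2⁻¹) * k2 := by positivity
    have e : k2⁻¹ * k2 = 1 := inv_mul_cancel₀ hk2.ne'
    rw [hc0]; linarith
  have b3 : 1 ≤ c0 * ρ1 := by
    have : 0 < (k⁻¹ + k2⁻¹ + ρ2⁻¹) * ρ1 := by positivity
    have e : ρ1⁻¹ * ρ1 = 1 := inv_mul_cancel₀ hρ1.ne'
    rw [hc0]; linarith
  have b4 : 1 ≤ c0 * ρ2 := by
    have : 0 < (k⁻¹ + k2⁻¹ + ρ1⁻¹) * ρ2 := by positivity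
    have e : ρ2⁻¹ * ρ2 = 1 := inv_mul_cancel₀ hρ2.ne'
    rw [hc0]; linarith
  refine ⟨X * c0 + (3 * c0 + 3 * (1 + l ^ 2) * L * (X * c0)), by positivity, ?_⟩
  intro u1 u3 u5 P1 P3 P5 z1 z3 z5 c1 c3 c5 C1 C3 C5 Z1 Z3 Z5 d1 d3 d5 b
  have iN : IntervalIntegrable (bhN k k2 ρ1 ρ2 l u1 u3 u5 P1 P3 P5 z1 z3 z5) volume 0 L := by
    refine ContinuousOn.intervalIntegrable_of_Icc hL.le ?_
    unfold bhN
    fun_prop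
  set J := ∫ t in (0:ℝ)..L, bhN k k2 ρ1 ρ2 l u1 u3 u5 P1 P3 P5 z1 z3 z5 t with hJ
  have hJ0 : 0 ≤ J := intervalIntegral.integral_nonneg hL.le fun x _ => by
    unfold bhN; positivity
  have pw : ∀ x, ‖P1 x + u3 x + (l : ℂ) * u5 x‖ ^ 2 + ‖P3 x‖ ^ 2
        + ‖P5 x - (l : ℂ) * u1 x‖ ^ 2 + ‖z1 x‖ ^ 2 + ‖z3 x‖ ^ 2 + ‖z5 x‖ ^ 2
        ≤ c0 * bhN k k2 ρ1 ρ2 l u1 u3 u5 P1 P3 P5 z1 z3 z5 x := by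
    intro x
    have w1 := mul_le_mul_of_nonneg_right b1 (sq_nonneg ‖P1 x + u3 x + (l : ℂ) * u5 x‖)
    have w2 := mul_le_mul_of_nonneg_right b2 (sq_nonneg ‖P3 x‖)
    have w3 := mul_le_mul_of_nonneg_right b1 (sq_nonneg ‖P5 x - (l : ℂ) * u1 x‖)
    have w4 := mul_le_mul_of_nonneg_right b3 (sq_nonneg ‖z1 x‖)
    have w5 := mul_le_mul_of_nonneg_right b4 (sq_nonneg ‖z3 x‖)
    have w6 := mul_le_mul_of_nonneg_right b3 (sq_nonneg ‖z5 x‖)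
    unfold bhN
    linarith
  have sup : ∀ x ∈ Icc 0 L, ‖u1 x‖ ^ 2 + ‖u3 x‖ ^ 2 + ‖u5 x‖ ^ 2 ≤ X * c0 * J := by
    intro x hx
    refine (bh_h1 hl hL c1 c3 c5 C1 C3 C5 d1 d3 d5 b x hx).trans ?_
    rw [mul_assoc]
    refine mul_le_mul_of_nonneg_left ?_ hX0.le
    rw [hJ, ← intervalIntegral.integral_const_mul]
    refine intervalIntegral.integral_mono_on hL.le
      (ContinuousOn.intervalIntegrable_of_Icc hL.le (by fun_prop)) (iN.const_mul _) fun y _ => ?_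
    have := pw y
    have s1 := sq_nonneg ‖z1 y‖
    have s2 := sq_nonneg ‖z3 y‖
    have s3 := sq_nonneg ‖z5 y‖
    linarith
  constructor
  · intro x hx
    refine (sup x hx).trans (mul_le_mul_of_nonneg_right ?_ hJ0)
    have : 0 ≤ 3 * c0 + 3 * (1 + l ^ 2) * L * (X * c0) := by positivity
    linarith
  · have hm : ∫ x in (0:ℝ)..L, (‖P1 x‖ ^ 2 + ‖P3 x‖ ^ 2 + ‖P5 x‖ ^ 2 + ‖z1 x‖ ^ 2 + ‖z3 x‖ ^ 2
        + ‖z5 x‖ ^ 2) ≤ ∫ x in (0:ℝ)..L, ((3 * c0) * bhN k k2 ρ1 ρ2 l u1 u3 u5 P1 P3 P5 z1 z3 z5 x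
          + 3 * (1 + l ^ 2) * (X * c0 * J)) := by
      refine intervalIntegral.integral_mono_on hL.le
        (ContinuousOn.intervalIntegrable_of_Icc hL.le (by fun_prop))
        ((iN.const_mul _).add intervalIntegrable_const) fun x hx => ?_
      have nl : ‖(l : ℂ)‖ = l := by simp [abs_of_pos hl]
      have n1 : ‖P1 x‖ ≤ ‖P1 x + u3 x + (l : ℂ) * u5 x‖ + ‖u3 x‖ + l * ‖u5 x‖ := by
        have e1 : P1 x = (P1 x + u3 x + (l : ℂ) * u5 x) - u3 x - (l : ℂ) * u5 x := by ring
        conv_lhs => rw [e1]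
        refine (norm_sub_le _ _).trans (add_le_add (norm_sub_le _ _) ?_)
        rw [norm_mul, nl]
      have n5 : ‖P5 x‖ ≤ ‖P5 x - (l : ℂ) * u1 x‖ + l * ‖u1 x‖ := by
        have e5 : P5 x = (P5 x - (l : ℂ) * u1 x) + (l : ℂ) * u1 x := by ring
        conv_lhs => rw [e5]
        refine (norm_add_le _ _).trans (add_le_add le_rfl ?_)
        rw [norm_mul, nl]
      have m1 : ‖P1 x‖ ^ 2 ≤ 3 * (‖P1 x + u3 x + (l : ℂ) * u5 x‖ ^ 2 + ‖u3 x‖ ^ 2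
          + l ^ 2 * ‖u5 x‖ ^ 2) := by
        have := pow_le_pow_left₀ (norm_nonneg _) n1 2
        have t1 := sq_nonneg (‖P1 x + u3 x + (l : ℂ) * u5 x‖ - ‖u3 x‖)
        have t2 := sq_nonneg (‖P1 x + u3 x + (l : ℂ) * u5 x‖ - l * ‖u5 x‖)
        have t3 := sq_nonneg (‖u3 x‖ - l * ‖u5 x‖)
        nlinarith
      have m5 : ‖P5 x‖ ^ 2 ≤ 2 * (‖P5 x - (l : ℂ) * u1 x‖ ^ 2 + l ^ 2 * ‖u1 x‖ ^ 2) := by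
        have := pow_le_pow_left₀ (norm_nonneg _) n5 2
        have t1 := sq_nonneg (‖P5 x - (l : ℂ) * u1 x‖ - l * ‖u1 x‖)
        nlinarith
      have h1 := pw x
      have h2 := mul_le_mul_of_nonneg_left (sup x hx)
        (show 0 ≤ 3 * (1 + l ^ 2) by positivity)
      have s1 := sq_nonneg ‖z1 x‖
      have s2 := sq_nonneg ‖z3 x‖
      have s3 := sq_nonneg ‖z5 x‖
      have s4 := sq_nonneg ‖P3 x‖
      have s5 := sq_nonneg ‖P5 x - (l : ℂ) * u1 x‖
      have s6 := sq_nonneg ‖u1 x‖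
      have s7 := sq_nonneg ‖u5 x‖
      have s8 := mul_nonneg (sq_nonneg l) s6
      have s9 := mul_nonneg (sq_nonneg l) (sq_nonneg ‖u3 x‖)
      linarith
    refine hm.trans ?_
    rw [intervalIntegral.integral_add (iN.const_mul _) intervalIntegrable_const,
      intervalIntegral.integral_const_mul, intervalIntegral.integral_const]
    simp only [smul_eq_mul, sub_zero]
    have : 0 ≤ X * c0 * J := by positivity
    rw [← hJ]
    nlinarith

lemma bh_seq {k k2 ρ1 ρ2 l L β a0 : ℝ} (hk : 0 < k) (hk2 : 0 < k2) (hρ1 : 0 < ρ1)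
    (hρ2 : 0 < ρ2) (hl : 0 < l) (ha : 0 < a0) (hβ : 0 < β) (hβL : β < L)
    (hsp : k * ρ2 = k2 * ρ1) {lam : ℕ → ℝ} (hlam : ∀ n, lam n ≠ 0)
    (hlim : Tendsto (fun n => |lam n|) atTop atTop)
    {v1 v3 v5 p1 p3 p5 q1 q3 q5 f1 f3 f5 G1 G3 G5 f2 f4 f6 : ℕ → ℝ → ℂ}
    (C : ∀ n, BhClean k k2 ρ1 ρ2 l L β a0 (lam n) (v1 n) (v3 n) (v5 n) (p1 n) (p3 n) (p5 n)
      (q1 n) (q3 n) (q5 n) (f1 n) (f3 n) (f5 n) (G1 n) (G3 n) (G5 n) (f2 n) (f4 n) (f6 n))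
    (hU : ∀ n, ∫ x in (0:ℝ)..L, bhN k k2 ρ1 ρ2 l (v1 n) (v3 n) (v5 n) (p1 n) (p3 n) (p5 n)
      (q1 n) (q3 n) (q5 n) x = 1)
    (hF : Tendsto (fun n => ∫ x in (0:ℝ)..L, bhN k k2 ρ1 ρ2 l (f1 n) (f3 n) (f5 n) (G1 n) (G3 n)
      (G5 n) (f2 n) (f4 n) (f6 n) x) atTop (nhds 0)) :
    ∃ η : ℕ → ℝ, Tendsto η atTop (nhds 0) ∧ ∀ n, ∀ x ∈ Icc 0 L,
      (lam n) ^ 2 * ‖v1 n x‖ ^ 2 + (lam n) ^ 2 * ‖v3 n x‖ ^ 2 + (lam n) ^ 2 * ‖v5 n x‖ ^ 2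
      + ‖p1 n x‖ ^ 2 + ‖p3 n x‖ ^ 2 + ‖p5 n x‖ ^ 2 ≤ η n := by
  have hL : 0 < L := hβ.trans hβL
  obtain ⟨K, hK, ctrl⟩ := bh_ctrl hk hk2 hρ1 hρ2 hl hL
  have cU := fun n => ctrl (C n).cv1 (C n).cv3 (C n).cv5 (C n).cp1 (C n).cp3 (C n).cp5 (C n).cq1
    (C n).cq3 (C n).cq5 (C n).dv1 (C n).dv3 (C n).dv5 (C n).bv
  have cF := fun n => ctrl (C n).cf1 (C n).cf3 (C n).cf5 (C n).cG1 (C n).cG3 (C n).cG5 (C n).cf2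
    (C n).cf4 (C n).cf6 (C n).df1 (C n).df3 (C n).df5 (C n).bf
  simp only [hU, mul_one] at cU
  set Φ : ℕ → ℝ := fun n => ∫ x in (0:ℝ)..L, bhN k k2 ρ1 ρ2 l (f1 n) (f3 n) (f5 n) (G1 n) (G3 n)
      (G5 n) (f2 n) (f4 n) (f6 n) x with hΦ
  have hΦ0 : ∀ n, 0 ≤ Φ n := fun n => intervalIntegral.integral_nonneg hL.le fun x _ => by
    unfold bhN; positivity
  have hKΦ : Tendsto (fun n => K * Φ n) atTop (nhds 0) := by simpa using hF.const_mul K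
  have L2 : ∀ {u : ℝ → ℂ}, ContinuousOn u (Icc 0 L) → BhL2 L u := fun h => BhL2.of_cont hL.le h
  -- a component of the sum tends to zero
  have comp : ∀ u : ℕ → ℝ → ℂ, (∀ n, ContinuousOn (u n) (Icc 0 L)) →
      (∀ n x, ‖u n x‖ ^ 2 ≤ ‖G1 n x‖ ^ 2 + ‖G3 n x‖ ^ 2 + ‖G5 n x‖ ^ 2 + ‖f2 n x‖ ^ 2
        + ‖f4 n x‖ ^ 2 + ‖f6 n x‖ ^ 2) → BhT2 L u := by
    intro u hu hle
    refine BhT2.of_le hL.le (fun n => L2 (hu n)) hKΦ fun n => le_trans ?_ (cF n).2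
    have a1 := (C n).cG1
    have a2 := (C n).cG3
    have a3 := (C n).cG5
    have a4 := (C n).cf2
    have a5 := (C n).cf4
    have a6 := (C n).cf6
    exact intervalIntegral.integral_mono_on hL.le (L2 (hu n)).2
      (ContinuousOn.intervalIntegrable_of_Icc hL.le (by fun_prop)) fun x _ => hle n x
  have tG1 : BhT2 L G1 := comp G1 (fun n => (C n).cG1) fun n x => by
    linarith [sq_nonneg ‖G3 n x‖, sq_nonneg ‖G5 n x‖, sq_nonneg ‖f2 n x‖, sq_nonneg ‖f4 n x‖,
      sq_nonneg ‖f6 n x‖]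
  have tG3 : BhT2 L G3 := comp G3 (fun n => (C n).cG3) fun n x => by
    linarith [sq_nonneg ‖G1 n x‖, sq_nonneg ‖G5 n x‖, sq_nonneg ‖f2 n x‖, sq_nonneg ‖f4 n x‖,
      sq_nonneg ‖f6 n x‖]
  have tG5 : BhT2 L G5 := comp G5 (fun n => (C n).cG5) fun n x => by
    linarith [sq_nonneg ‖G3 n x‖, sq_nonneg ‖G1 n x‖, sq_nonneg ‖f2 n x‖, sq_nonneg ‖f4 n x‖,
      sq_nonneg ‖f6 n x‖]
  have tf2 : BhT2 L f2 := comp f2 (fun n => (C n).cf2) fun n x => by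
    linarith [sq_nonneg ‖G3 n x‖, sq_nonneg ‖G5 n x‖, sq_nonneg ‖G1 n x‖, sq_nonneg ‖f4 n x‖,
      sq_nonneg ‖f6 n x‖]
  have tf4 : BhT2 L f4 := comp f4 (fun n => (C n).cf4) fun n x => by
    linarith [sq_nonneg ‖G3 n x‖, sq_nonneg ‖G5 n x‖, sq_nonneg ‖f2 n x‖, sq_nonneg ‖G1 n x‖,
      sq_nonneg ‖f6 n x‖]
  have tf6 : BhT2 L f6 := comp f6 (fun n => (C n).cf6) fun n x => by
    linarith [sq_nonneg ‖G3 n x‖, sq_nonneg ‖G5 n x‖, sq_nonneg ‖f2 n x‖, sq_nonneg ‖f4 n x‖,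
      sq_nonneg ‖G1 n x‖]
  -- pointwise relation
  have vq : ∀ n, ∀ {v q f : ℂ}, Complex.I * lam n * v - f = q →
      (lam n) ^ 2 * ‖v‖ ^ 2 ≤ 2 * ‖q‖ ^ 2 + 2 * ‖f‖ ^ 2 := by
    intro n v q f h
    have e : Complex.I * lam n * v = q + f := by rw [← h]; ring
    have e2 := congrArg norm e
    rw [norm_mul, norm_mul, Complex.norm_I, one_mul, Complex.norm_real] at e2
    have e3 := norm_add_le q f
    rw [← e2] at e3
    have e4 := pow_le_pow_left₀ (by positivity) e3 2
    rw [mul_pow, Real.norm_eq_abs, sq_abs] at e4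
    have := sq_nonneg (‖q‖ - ‖f‖)
    linarith
  obtain ⟨B, hB⟩ := hKΦ.bddAbove_range
  have hB' : ∀ n, K * Φ n ≤ B := fun n => hB ⟨n, rfl⟩
  have hli : Tendsto (fun n => ((lam n) ^ 2)⁻¹) atTop (nhds 0) := by
    have h := (hlim.inv_tendsto_atTop).pow 2
    simp only [ne_eq, OfNat.ofNat_ne_zero, not_false_eq_true, zero_pow] at h
    refine h.congr fun n => ?_
    simp
  have vT : ∀ v q f : ℕ → ℝ → ℂ, (∀ n, ContinuousOn (v n) (Icc 0 L)) →
      (∀ n, ContinuousOn (q n) (Icc 0 L)) →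
      (∀ n, ∀ x ∈ Icc 0 L, Complex.I * lam n * v n x - f n x = q n x) →
      (∀ n, ∀ x ∈ Icc 0 L, ‖f n x‖ ^ 2 ≤ K * Φ n) →
      (∀ n, ∫ x in (0:ℝ)..L, ‖q n x‖ ^ 2 ≤ K) → BhT2 L v := by
    intro v q f cv cq he hf hq
    have hd : Tendsto (fun n => ((lam n) ^ 2)⁻¹ * (2 * K + L * (2 * B))) atTop (nhds 0) := by
      simpa using hli.mul_const (2 * K + L * (2 * B))
    refine BhT2.of_le hL.le (fun n => L2 (cv n)) hd fun n => ?_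
    have hl2 : 0 < (lam n) ^ 2 := by have := hlam n; positivity
    have h1 : ∫ x in (0:ℝ)..L, ‖v n x‖ ^ 2
        ≤ ∫ x in (0:ℝ)..L, ((lam n) ^ 2)⁻¹ * (2 * ‖q n x‖ ^ 2 + 2 * B) := by
      refine intervalIntegral.integral_mono_on hL.le (L2 (cv n)).2
        (((((L2 (cq n)).2).const_mul 2).add intervalIntegrable_const).const_mul _) fun x hx => ?_
      rw [← div_eq_inv_mul, le_div_iff₀ hl2]
      have a1 := vq n (he n x hx)
      have a2 := (hf n x hx).trans (hB' n)
      linarith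
    refine h1.trans ?_
    rw [intervalIntegral.integral_const_mul,
      intervalIntegral.integral_add (((L2 (cq n)).2).const_mul 2) intervalIntegrable_const,
      intervalIntegral.integral_const_mul, intervalIntegral.integral_const]
    refine mul_le_mul_of_nonneg_left ?_ (inv_nonneg.2 hl2.le)
    have := hq n
    simp only [smul_eq_mul, sub_zero]
    linarith
  have cQ : ∀ n, ∀ q : ℝ → ℂ, ContinuousOn q (Icc 0 L) → (∀ x, ‖q x‖ ^ 2 ≤ ‖p1 n x‖ ^ 2
      + ‖p3 n x‖ ^ 2 + ‖p5 n x‖ ^ 2 + ‖q1 n x‖ ^ 2 + ‖q3 n x‖ ^ 2 + ‖q5 n x‖ ^ 2) →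
      ∫ x in (0:ℝ)..L, ‖q x‖ ^ 2 ≤ K := by
    intro n q cq hle
    refine le_trans ?_ (cU n).2
    have a1 := (C n).cp1
    have a2 := (C n).cp3
    have a3 := (C n).cp5
    have a4 := (C n).cq1
    have a5 := (C n).cq3
    have a6 := (C n).cq5
    exact intervalIntegral.integral_mono_on hL.le (L2 cq).2
      (ContinuousOn.intervalIntegrable_of_Icc hL.le (by fun_prop)) fun x _ => hle x
  have tv1 : BhT2 L v1 := vT v1 q1 f1 (fun n => (C n).cv1) (fun n => (C n).cq1)
    (fun n => (C n).e1) (fun n x hx => by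
      have := (cF n).1 x hx
      linarith [sq_nonneg ‖f3 n x‖, sq_nonneg ‖f5 n x‖])
    (fun n => cQ n (q1 n) (C n).cq1 fun x => by
      linarith [sq_nonneg ‖p1 n x‖, sq_nonneg ‖p3 n x‖, sq_nonneg ‖p5 n x‖, sq_nonneg ‖q3 n x‖,
        sq_nonneg ‖q5 n x‖])
  have tv3 : BhT2 L v3 := vT v3 q3 f3 (fun n => (C n).cv3) (fun n => (C n).cq3)
    (fun n => (C n).e3) (fun n x hx => by
      have := (cF n).1 x hx
      linarith [sq_nonneg ‖f1 n x‖, sq_nonneg ‖f5 n x‖])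
    (fun n => cQ n (q3 n) (C n).cq3 fun x => by
      linarith [sq_nonneg ‖p1 n x‖, sq_nonneg ‖p3 n x‖, sq_nonneg ‖p5 n x‖, sq_nonneg ‖q1 n x‖,
        sq_nonneg ‖q5 n x‖])
  have tv5 : BhT2 L v5 := vT v5 q5 f5 (fun n => (C n).cv5) (fun n => (C n).cq5)
    (fun n => (C n).e5) (fun n x hx => by
      have := (cF n).1 x hx
      linarith [sq_nonneg ‖f1 n x‖, sq_nonneg ‖f3 n x‖])
    (fun n => cQ n (q5 n) (C n).cq5 fun x => by
      linarith [sq_nonneg ‖p1 n x‖, sq_nonneg ‖p3 n x‖, sq_nonneg ‖p5 n x‖, sq_nonneg ‖q3 n x‖,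
        sq_nonneg ‖q1 n x‖])
  -- dissipation
  have tA : BhT2 L (fun n x => (if x < β then (a0 : ℂ) else 0) * q5 n x) := by
    set τ : ℕ → ℝ := fun n => Real.sqrt (Φ n) + |lam n|⁻¹ with hτ
    have hτ0 : ∀ n, 0 < τ n := fun n =>
      add_pos_of_nonneg_of_pos (Real.sqrt_nonneg _) (inv_pos.2 (abs_pos.2 (hlam n)))
    have hτl : Tendsto τ atTop (nhds 0) := by
      have := hF.sqrt.add hlim.inv_tendsto_atTop
      simpa using this
    have hd : Tendsto (fun n => a0 * τ n) atTop (nhds 0) := by simpa using hτl.const_mul a0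
    refine BhT2.of_le hL.le (fun n => bh_damp_L2 (L2 (C n).cq5)) hd fun n => ?_
    refine (bh_diss hk hk2 hρ1 hρ2 ha hL (C n) (hτ0 n)).trans ?_
    rw [hU n]
    have h1 : (τ n)⁻¹ * Φ n ≤ τ n := by
      rw [inv_mul_le_iff₀ (hτ0 n)]
      have h2 : Real.sqrt (Φ n) ≤ τ n := by
        have : 0 ≤ |lam n|⁻¹ := by positivity
        simp only [hτ]; linarith
      have h3 := Real.mul_self_sqrt (hΦ0 n)
      have h4 := mul_self_le_mul_self (Real.sqrt_nonneg _) h2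
      linarith
    have h5 : a0 / 2 * (τ n * 1 + (τ n)⁻¹ * Φ n) ≤ a0 / 2 * (τ n * 1 + τ n) :=
      mul_le_mul_of_nonneg_left (by linarith) (by positivity)
    refine h5.trans (le_of_eq ?_)
    ring
  have hq5 : BhS β q5 := by
    have hsub : Icc 0 β ⊆ Icc 0 L := Icc_subset_Icc le_rfl hβL.le
    have hd := tA.2.const_mul ((a0 ^ 2)⁻¹)
    rw [mul_zero] at hd
    refine BhS.of_T2 (L := β) hβ le_rfl (BhT2.of_le hβ.le
      (fun n => BhL2.of_cont hβ.le ((C n).cq5.mono hsub)) hd fun n => ?_)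
    have e : ∫ x in (0:ℝ)..β, ‖q5 n x‖ ^ 2
        = (a0 ^ 2)⁻¹ * ∫ x in (0:ℝ)..β, ‖(if x < β then (a0 : ℂ) else 0) * q5 n x‖ ^ 2 := by
      rw [← intervalIntegral.integral_const_mul]
      refine intervalIntegral.integral_congr_Ioo_of_le hβ.le fun x hx => ?_
      simp only [if_pos hx.2, norm_mul, mul_pow, Complex.norm_real, Real.norm_eq_abs, sq_abs]
      field_simp
    rw [e]
    refine mul_le_mul_of_nonneg_left ?_ (by positivity)
    exact intervalIntegral.integral_mono_interval le_rfl hβ.le hβL.le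
      (Eventually.of_forall fun x => by positivity) (tA.1 n).2
  -- the core estimate
  have hk' : (k : ℂ) ≠ 0 := by exact_mod_cast hk.ne'
  have hk2' : (k2 : ℂ) ≠ 0 := by exact_mod_cast hk2.ne'
  have hsp' : (k : ℂ) * ρ2 = k2 * ρ1 := by exact_mod_cast hsp
  have dq : ∀ n, ∀ {v p q f G : ℝ → ℂ},
      (∀ x ∈ Icc 0 L, Complex.I * lam n * v x - f x = q x) →
      (∀ x ∈ Ioo 0 L, HasDerivAt v (p x) x) → (∀ x ∈ Ioo 0 L, HasDerivAt f (G x) x) →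
      ∀ x ∈ Ioo 0 L, x ≠ β → HasDerivAt q (Complex.I * lam n * p x + (-1 : ℂ) * G x) x := by
    intro n v p q f G he hv hf x hx _
    have h1 := ((hv x hx).const_mul (Complex.I * lam n)).sub (hf x hx)
    refine (h1.congr_of_eventuallyEq ?_).congr_deriv (by ring)
    filter_upwards [isOpen_Ioo.mem_nhds hx] with y hy
    rw [← he y ⟨hy.1.le, hy.2.le⟩]
    rfl
  obtain ⟨δ, hδ, hE⟩ := bh_core (k := k) (ρ := ρ1) (c := k ^ 2 / k2) (l := l) (L := L) (β := β)
    hk hρ1 (by positivity) hl hβ hβL hlam hlim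
    (p1 := p1) (q1 := q1) (s1 := fun n x => (-1 : ℂ) * G1 n x)
    (g1 := fun n x => ((l : ℂ) ^ 2 * k) * v1 n x + (-(ρ1 : ℂ)) * f2 n x)
    (p3 := p3) (q3 := q3) (s3 := fun n x => (-1 : ℂ) * G3 n x)
    (g3 := fun n x => (((k : ℂ) ^ 2 / k2) * v3 n x + ((k : ℂ) ^ 2 / k2 * l) * v5 n x)
      + (-(ρ1 : ℂ)) * f4 n x)
    (p5 := p5) (q5 := q5) (s5 := fun n x => (-1 : ℂ) * G5 n x)
    (g5 := fun n x => ((((l : ℂ) * k) * v3 n x + ((l : ℂ) ^ 2 * k) * v5 n x)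
      + (if x < β then (a0 : ℂ) else 0) * q5 n x) + (-(ρ1 : ℂ)) * f6 n x)
    (fun n => ⟨(C n).cp1, (C n).cq1, fun x hx hxb => ((C n).dp1 x hx hxb).congr_deriv (by ring),
      dq n (C n).e1 (C n).dv1 (C n).df1⟩)
    (fun n => ⟨(C n).cp3, (C n).cq3, fun x hx hxb => ((C n).dp3 x hx hxb).congr_deriv (by
        push_cast
        rw [div_eq_div_iff hk2' hk']
        field_simp
        linear_combination (Complex.I * lam n * q3 n x - f4 n x) * hsp'),
      dq n (C n).e3 (C n).dv3 (C n).df3⟩)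
    (fun n => ⟨(C n).cp5, (C n).cq5, fun x hx hxb => ((C n).dp5 x hx hxb).congr_deriv (by ring),
      dq n (C n).e5 (C n).dv5 (C n).df5⟩)
    ((tv1.const_mul _).add hL.le (tf2.const_mul _))
    (((tv3.const_mul _).add hL.le (tv5.const_mul _)).add hL.le (tf4.const_mul _))
    ((((tv3.const_mul _).add hL.le (tv5.const_mul _)).add hL.le tA).add hL.le (tf6.const_mul _))
    (tG1.const_mul _) (tG3.const_mul _) (tG5.const_mul _)
    ((k + ρ1) * K) (fun n => by
      have a1 := (C n).cp1
      have a2 := (C n).cp3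
      have a3 := (C n).cp5
      have a4 := (C n).cq1
      have a5 := (C n).cq3
      have a6 := (C n).cq5
      refine le_trans ?_ (mul_le_mul_of_nonneg_left (cU n).2 (by positivity))
      rw [← intervalIntegral.integral_const_mul]
      refine intervalIntegral.integral_mono_on hL.le
        (ContinuousOn.intervalIntegrable_of_Icc hL.le (by fun_prop))
        (ContinuousOn.intervalIntegrable_of_Icc hL.le (by fun_prop)) fun x _ => ?_
      have : 0 ≤ ρ1 * (‖p1 n x‖ ^ 2 + ‖p3 n x‖ ^ 2 + ‖p5 n x‖ ^ 2) := by positivity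
      have : 0 ≤ k * (‖q1 n x‖ ^ 2 + ‖q3 n x‖ ^ 2 + ‖q5 n x‖ ^ 2) := by positivity
      linarith) hq5
  refine ⟨fun n => (k⁻¹ + 2 * ρ1⁻¹) * δ n + 2 * (K * Φ n), ?_, fun n x hx => ?_⟩
  · simpa using (hδ.const_mul (k⁻¹ + 2 * ρ1⁻¹)).add (hKΦ.const_mul 2)
  · have h1 := hE n x hx
    have h2 := (cF n).1 x hx
    have w1 := vq n ((C n).e1 x hx)
    have w3 := vq n ((C n).e3 x hx)
    have w5 := vq n ((C n).e5 x hx)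
    set P := ‖p1 n x‖ ^ 2 + ‖p3 n x‖ ^ 2 + ‖p5 n x‖ ^ 2 with hP
    set Q := ‖q1 n x‖ ^ 2 + ‖q3 n x‖ ^ 2 + ‖q5 n x‖ ^ 2 with hQ
    have hP0 : 0 ≤ P := by positivity
    have hQ0 : 0 ≤ Q := by positivity
    have h3 : k * P + ρ1 * Q ≤ δ n := by rw [hP, hQ]; linarith
    have h4 : P ≤ k⁻¹ * δ n := by
      rw [← div_eq_inv_mul, le_div_iff₀ hk]
      have := mul_nonneg hρ1.le hQ0
      linarith
    have h5 : Q ≤ ρ1⁻¹ * δ n := by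
      rw [← div_eq_inv_mul, le_div_iff₀ hρ1]
      have := mul_nonneg hk.le hP0
      linarith
    have h6 : (lam n) ^ 2 * ‖v1 n x‖ ^ 2 + (lam n) ^ 2 * ‖v3 n x‖ ^ 2 + (lam n) ^ 2 * ‖v5 n x‖ ^ 2
        ≤ 2 * Q + 2 * (K * Φ n) := by rw [hQ]; linarith
    linarith

lemma bh_int_le {a b c : ℝ} (hab : a ≤ b) {h g : ℝ → ℝ} (he : ∀ x ∈ Ioo a b, h x = g x)
    (h0 : ∀ x, 0 ≤ g x) (hc : ∀ x ∈ Icc a b, g x ≤ c) :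
    0 ≤ ∫ x in a..b, h x ∧ ∫ x in a..b, h x ≤ c * (b - a) := by
  rw [intervalIntegral.integral_congr_Ioo_of_le hab he]
  refine ⟨intervalIntegral.integral_nonneg hab fun x _ => h0 x, ?_⟩
  have := intervalIntegral.norm_integral_le_of_norm_le_const (a := a) (b := b) (f := g) (C := c)
    (fun x hx => by
      rw [uIoc_of_le hab] at hx
      rw [Real.norm_eq_abs, abs_of_nonneg (h0 x)]
      exact hc x ⟨hx.1.le, hx.2⟩)
  rw [abs_of_nonneg (sub_nonneg.2 hab)] at this
  exact (le_abs_self _).trans this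


theorem bresse_lemma7_H1 (ρ₁ ρ₂ k₁ k₂ k₃ l L β a₀ : ℝ) (ℓ : ℕ)
    (hrho1 : 0 < ρ₁) (hrho2 : 0 < ρ₂) (hk1 : 0 < k₁) (hk2 : 0 < k₂) (hk3 : 0 < k₃)
    (hl : 0 < l) (hL : 0 < L) (ha0 : 0 < a₀) (hbeta : 0 < β) (hbetaL : β < L)
    (S : BresseSetting ρ₁ ρ₂ k₁ k₂ k₃ l L β a₀ ℓ)
    (hH : k₁ / ρ₁ = k₂ / ρ₂ ∧ k₁ = k₃ ∧ ℓ = 0) :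
    ∀ ε : ℝ, 0 < ε → ε < β / 12 →
    Tendsto (fun n =>
      (∫ x in (0 : ℝ)..(4 * ε),
        (ρ₁ * (S.lam n) ^ 2 * ‖S.v1 n x‖ ^ 2 + k₁ * ‖deriv (S.v1 n) x‖ ^ 2
          + ρ₂ * (S.lam n) ^ 2 * ‖S.v3 n x‖ ^ 2 + k₂ * ‖deriv (S.v3 n) x‖ ^ 2
          + k₃ * ‖deriv (S.v5 n) x‖ ^ 2))
      + (∫ x in (β - 4 * ε)..L,
        (ρ₁ * (S.lam n) ^ 2 * ‖S.v1 n x‖ ^ 2 + k₁ * ‖deriv (S.v1 n) x‖ ^ 2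
          + ρ₂ * (S.lam n) ^ 2 * ‖S.v3 n x‖ ^ 2 + k₂ * ‖deriv (S.v3 n) x‖ ^ 2
          + k₃ * ‖deriv (S.v5 n) x‖ ^ 2))
      + ρ₁ * (S.lam n) ^ 2 * ∫ x in β..L, ‖S.v5 n x‖ ^ 2) atTop (nhds 0) := by
  obtain ⟨hsp, rfl, rfl⟩ := hH
  intro ε hε hεβ
  have r1 := fun n => bh_reg1 hL ((S.reg_v1 n).of_le one_le_two)
  have r3 := fun n => bh_reg1 hL ((S.reg_v3 n).of_le one_le_two)
  have r5 := fun n => bh_reg1 hL (S.reg_v5 n)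
  have s1 := fun n => bh_reg1 hL (S.reg_f1 n)
  have s3 := fun n => bh_reg1 hL (S.reg_f3 n)
  have s5 := fun n => bh_reg1 hL (S.reg_f5 n)
  have hsp' : k₁ * ρ₂ = k₂ * ρ₁ := by
    rwa [div_eq_div_iff hrho1.ne' hrho2.ne'] at hsp
  obtain ⟨η, hη, hb⟩ := bh_seq hk1 hk2 hrho1 hrho2 hl ha0 hbeta hbetaL hsp' S.lam_ne
    S.lam_tendsto (fun n => bh_clean hk1 hk2 hL hbeta hbetaL S n)
    (fun n => by
      rw [← S.normU n]
      refine intervalIntegral.integral_congr_Ioo_of_le hL.le fun x hx => ?_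
      simp only [bhN, (r1 n).2.2 x hx, (r3 n).2.2 x hx, (r5 n).2.2 x hx])
    (by
      refine S.normF.congr fun n => ?_
      refine intervalIntegral.integral_congr_Ioo_of_le hL.le fun x hx => ?_
      simp only [bhN, (s1 n).2.2 x hx, (s3 n).2.2 x hx, (s5 n).2.2 x hx])
  set c : ℝ := ρ₁ + k₁ + ρ₂ + k₂ + k₁ with hc
  have hη0 : ∀ n, 0 ≤ η n := fun n => le_trans (by positivity) (hb n 0 ⟨le_rfl, hL.le⟩)
  have main : ∀ n, ∀ a b : ℝ, 0 ≤ a → a ≤ b → b ≤ L →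
      0 ≤ (∫ x in a..b, (ρ₁ * (S.lam n) ^ 2 * ‖S.v1 n x‖ ^ 2 + k₁ * ‖deriv (S.v1 n) x‖ ^ 2
          + ρ₂ * (S.lam n) ^ 2 * ‖S.v3 n x‖ ^ 2 + k₂ * ‖deriv (S.v3 n) x‖ ^ 2
          + k₁ * ‖deriv (S.v5 n) x‖ ^ 2)) ∧
      (∫ x in a..b, (ρ₁ * (S.lam n) ^ 2 * ‖S.v1 n x‖ ^ 2 + k₁ * ‖deriv (S.v1 n) x‖ ^ 2
          + ρ₂ * (S.lam n) ^ 2 * ‖S.v3 n x‖ ^ 2 + k₂ * ‖deriv (S.v3 n) x‖ ^ 2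
          + k₁ * ‖deriv (S.v5 n) x‖ ^ 2)) ≤ c * η n * (b - a) := by
    intro n a b ha hab hbL
    refine bh_int_le hab (g := fun x => ρ₁ * (S.lam n) ^ 2 * ‖S.v1 n x‖ ^ 2
      + k₁ * ‖derivWithin (S.v1 n) (Icc 0 L) x‖ ^ 2
      + ρ₂ * (S.lam n) ^ 2 * ‖S.v3 n x‖ ^ 2 + k₂ * ‖derivWithin (S.v3 n) (Icc 0 L) x‖ ^ 2
      + k₁ * ‖derivWithin (S.v5 n) (Icc 0 L) x‖ ^ 2) (fun x hx => ?_) (fun x => by positivity)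
      (fun x hx => ?_)
    · have hx' : x ∈ Ioo 0 L := ⟨ha.trans_lt hx.1, hx.2.trans_le hbL⟩
      simp only [(r1 n).2.2 x hx', (r3 n).2.2 x hx', (r5 n).2.2 x hx']
    · have h := hb n x ⟨ha.trans hx.1, hx.2.trans hbL⟩
      have y1 : 0 ≤ S.lam n ^ 2 * ‖S.v1 n x‖ ^ 2 := by positivity
      have y2 : 0 ≤ S.lam n ^ 2 * ‖S.v3 n x‖ ^ 2 := by positivity
      have y3 : 0 ≤ S.lam n ^ 2 * ‖S.v5 n x‖ ^ 2 := by positivity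
      have y4 := sq_nonneg ‖derivWithin (S.v1 n) (Icc 0 L) x‖
      have y5 := sq_nonneg ‖derivWithin (S.v3 n) (Icc 0 L) x‖
      have y6 := sq_nonneg ‖derivWithin (S.v5 n) (Icc 0 L) x‖
      have z1 := mul_le_mul_of_nonneg_left
        (show S.lam n ^ 2 * ‖S.v1 n x‖ ^ 2 ≤ η n by linarith) hrho1.le
      have z2 := mul_le_mul_of_nonneg_left
        (show ‖derivWithin (S.v1 n) (Icc 0 L) x‖ ^ 2 ≤ η n by linarith) hk1.le
      have z3 := mul_le_mul_of_nonneg_left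
        (show S.lam n ^ 2 * ‖S.v3 n x‖ ^ 2 ≤ η n by linarith) hrho2.le
      have z4 := mul_le_mul_of_nonneg_left
        (show ‖derivWithin (S.v3 n) (Icc 0 L) x‖ ^ 2 ≤ η n by linarith) hk2.le
      have z5 := mul_le_mul_of_nonneg_left
        (show ‖derivWithin (S.v5 n) (Icc 0 L) x‖ ^ 2 ≤ η n by linarith) hk1.le
      rw [hc]
      linarith
  have last : ∀ n, 0 ≤ ρ₁ * (S.lam n) ^ 2 * (∫ x in β..L, ‖S.v5 n x‖ ^ 2) ∧
      ρ₁ * (S.lam n) ^ 2 * (∫ x in β..L, ‖S.v5 n x‖ ^ 2) ≤ ρ₁ * η n * (L - β) := by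
    intro n
    rw [← intervalIntegral.integral_const_mul]
    refine bh_int_le hbetaL.le (fun x _ => rfl) (fun x => by positivity) (fun x hx => ?_)
    have h := hb n x ⟨hbeta.le.trans hx.1, hx.2⟩
    rw [mul_assoc]
    refine mul_le_mul_of_nonneg_left (le_trans ?_ h) hrho1.le
    have y1 : 0 ≤ S.lam n ^ 2 * ‖S.v1 n x‖ ^ 2 := by positivity
    have y2 : 0 ≤ S.lam n ^ 2 * ‖S.v3 n x‖ ^ 2 := by positivity
    have y4 := sq_nonneg ‖derivWithin (S.v1 n) (Icc 0 L) x‖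
    have y5 := sq_nonneg ‖derivWithin (S.v3 n) (Icc 0 L) x‖
    have y6 := sq_nonneg ‖derivWithin (S.v5 n) (Icc 0 L) x‖
    linarith
  have hlim : Tendsto (fun n => c * η n * (4 * ε - 0) + c * η n * (L - (β - 4 * ε))
      + ρ₁ * η n * (L - β)) atTop (nhds 0) := by
    have := (((hη.const_mul c).mul_const (4 * ε - 0)).add
      ((hη.const_mul c).mul_const (L - (β - 4 * ε)))).add
      ((hη.const_mul ρ₁).mul_const (L - β))
    simpa using this
  have m1 := fun n => main n 0 (4 * ε) le_rfl (by linarith) (by linarith)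
  have m2 := fun n => main n (β - 4 * ε) L (by linarith) (by linarith) le_rfl
  exact squeeze_zero (fun n => add_nonneg (add_nonneg (m1 n).1 (m2 n).1) (last n).1)
    (fun n => add_le_add (add_le_add (m1 n).2 (m2 n).2) (last n).2) hlim
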